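/- arXiv:1412.4268 — 13 statements merged into one kernel-verified Lean document; each statement's English description precedes it below -/
import Mathlib

section
/- Let X be a topological space and x ∈ X a point such that X has the strong Pytkeev property at x (i.e., there exists a countable Pytkeev network at x). Then X has countable k-character at x, i.e., there exists a countable local k-network at x. -/
open Set Filter Topology

/-- A set `A` accumulates at a point `x` if every neighborhood of `x`
contains infinitely many points of `A`. -/
def Accumulates {X : Type*} [TopologicalSpace X] (A : Set X) (x : X) : Prop :=
  ∀ O ∈ 𝓝 x, (O ∩ A).Infinite

/-- A family `𝒩` of subsets is a Pytkeev network at `x`. -/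
def IsPytkeevNetworkAt {X : Type*} [TopologicalSpace X] (𝒩 : Set (Set X)) (x : X) : Prop :=
  ∀ O ∈ 𝓝 x, ∀ A : Set X, Accumulates A x → ∃ N ∈ 𝒩, N ⊆ O ∧ (N ∩ A).Infinite

/-- `X` has the strong Pytkeev property at `x`. -/
def StrongPytkeevAt (X : Type*) [TopologicalSpace X] (x : X) : Prop :=
  ∃ 𝒩 : Set (Set X), 𝒩.Countable ∧ IsPytkeevNetworkAt 𝒩 x

/-- A family `𝒩` of subsets is a local k-network at `x`. -/
def IsLocalKNetworkAt {X : Type*} [TopologicalSpace X] (𝒩 : Set (Set X)) (x : X) : Prop :=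
  ∀ O ∈ 𝓝 x, ∃ U ∈ 𝓝 x, ∀ K : Set X, IsCompact K → K ⊆ U →
    ∃ ℱ ⊆ 𝒩, ℱ.Finite ∧ K ⊆ ⋃₀ ℱ ∧ ⋃₀ ℱ ⊆ O

/-- A set meeting every neighborhood of `x` accumulates at `x`, unless one of its points
belongs to all neighborhoods of `x`. -/
theorem accumulates_of_disjoint_ker {X : Type*} [TopologicalSpace X] {x : X} {A : Set X}
    (hA : ∀ U ∈ 𝓝 x, (U ∩ A).Nonempty) (hd : ∀ a ∈ A, a ∉ (𝓝 x).ker) : Accumulates A x := by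
  intro O hO hfin
  have hsep : ∀ a ∈ O ∩ A, ∃ V ∈ 𝓝 x, a ∉ V := by
    intro a ha
    simpa [Filter.mem_ker] using hd a ha.2
  choose! V hV haV using hsep
  have hW : O ∩ ⋂ a ∈ O ∩ A, V a ∈ 𝓝 x :=
    inter_mem hO ((biInter_mem hfin).2 hV)
  obtain ⟨a, ⟨haO, ha⟩, haA⟩ := hA _ hW
  exact haV a ⟨haO, haA⟩ (mem_iInter₂.1 ha a ⟨haO, haA⟩)

/-- A countable Pytkeev network at `x` yields countable tightness at `x`. -/
theorem IsPytkeevNetworkAt.exists_seq {X : Type*} [TopologicalSpace X] {x : X}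
    {𝒩 : Set (Set X)} (h𝒩 : IsPytkeevNetworkAt 𝒩 x) (hc : 𝒩.Countable) {A : Set X}
    (hA : ∀ U ∈ 𝓝 x, (U ∩ A).Nonempty) :
    ∃ y : ℕ → X, (∀ j, y j ∈ A) ∧ ∀ U ∈ 𝓝 x, ∃ j, y j ∈ U := by
  by_cases hd : ∀ a ∈ A, a ∉ (𝓝 x).ker
  · have hacc := accumulates_of_disjoint_ker hA hd
    have hne : {N ∈ 𝒩 | (N ∩ A).Nonempty}.Nonempty := by
      obtain ⟨N, hN, -, hinf⟩ := h𝒩 univ univ_mem A hacc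
      exact ⟨N, hN, hinf.nonempty⟩
    obtain ⟨g, hg⟩ := (hc.mono (sep_subset 𝒩 fun N => (N ∩ A).Nonempty)).exists_eq_range hne
    have hgA : ∀ j, (g j ∩ A).Nonempty := fun j =>
      (hg.symm ▸ mem_range_self j : g j ∈ {N ∈ 𝒩 | (N ∩ A).Nonempty}).2
    choose y hy using hgA
    refine ⟨y, fun j => (hy j).2, fun U hU => ?_⟩
    obtain ⟨N, hN, hNU, hinf⟩ := h𝒩 U hU A hacc
    obtain ⟨j, rfl⟩ : N ∈ range g := hg ▸ ⟨hN, hinf.nonempty⟩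
    exact ⟨j, hNU (hy j).1⟩
  · push Not at hd
    obtain ⟨a, haA, ha⟩ := hd
    exact ⟨fun _ => a, fun _ => haA, fun U hU => ⟨0, Filter.mem_ker.1 ha U hU⟩⟩

/-- A compact set covered by a sequence of sets, but not by finitely many of them, contains an
accumulation point of a set having finite intersection with each term of the sequence. -/
theorem IsCompact.exists_accumulates {X : Type*} [TopologicalSpace X] {K : Set X}
    (hK : IsCompact K) {f : ℕ → Set X} (hcov : K ⊆ ⋃ k, f k)
    (hbad : ∀ n, ¬ K ⊆ ⋃ i ≤ n, f i) :
    ∃ y ∈ K, ∃ A : Set X, Accumulates A y ∧ ∀ k, (f k ∩ A).Finite := by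
  have hpt : ∀ n, ∃ a ∈ K, ∀ i ≤ n, a ∉ f i := by
    intro n
    obtain ⟨a, haK, ha⟩ := not_subset.1 (hbad n)
    exact ⟨a, haK, by simpa using ha⟩
  choose a haK ha using hpt
  have hpre : ∀ k, (a ⁻¹' f k).Finite := fun k =>
    (finite_Iio k).subset fun n hn => not_le.1 fun hkn => ha n k hkn hn
  obtain ⟨y, hyK, hy⟩ := hK.exists_mapClusterPt (f := (atTop : Filter ℕ)) (u := a)
    (tendsto_principal.2 (Eventually.of_forall haK))
  refine ⟨y, hyK, range a, fun W hW hfin => ?_, fun k => ?_⟩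
  · have hfib : (a ⁻¹' (W ∩ range a)).Finite := by
      refine hfin.preimage' fun b hb => ?_
      obtain ⟨n, rfl⟩ := hb.2
      obtain ⟨k, hk⟩ := mem_iUnion.1 (hcov (haK n))
      exact (hpre k).subset (preimage_mono (singleton_subset_iff.2 hk))
    refine Nat.frequently_atTop_iff_infinite.1 (hy.frequently hW) (hfib.subset fun n hn => ?_)
    exact ⟨hn, mem_range_self n⟩
  · rw [← image_preimage_eq_inter_range]
    exact (hpre k).image a

/-- A countable Pytkeev network at `x` becomes a local k-network at `x` after adding the
intersection of all neighborhoods of `x`. -/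
theorem IsPytkeevNetworkAt.isLocalKNetworkAt_insert_ker {X : Type*} [TopologicalSpace X] {x : X}
    {𝒩 : Set (Set X)} (h𝒩 : IsPytkeevNetworkAt 𝒩 x) (hc : 𝒩.Countable) :
    IsLocalKNetworkAt (insert (𝓝 x).ker 𝒩) x := by
  intro O hO
  have hkerO : (𝓝 x).ker ⊆ O := fun a ha => Filter.mem_ker.1 ha O hO
  obtain ⟨f, hf⟩ := ((hc.insert (𝓝 x).ker).mono
    (sep_subset _ fun N => N ⊆ O)).exists_eq_range ⟨_, mem_insert _ _, hkerO⟩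
  have hf_mem : ∀ k, f k ∈ insert (𝓝 x).ker 𝒩 ∧ f k ⊆ O := fun k =>
    (hf.symm ▸ mem_range_self k : f k ∈ {N ∈ insert (𝓝 x).ker 𝒩 | N ⊆ O})
  have hf_surj : ∀ N ∈ insert (𝓝 x).ker 𝒩, N ⊆ O → ∃ k, f k = N := fun N hN hNO =>
    (hf ▸ ⟨hN, hNO⟩ : N ∈ range f)
  have not_acc : ∀ A, Accumulates A x → ¬ ∀ k, (f k ∩ A).Finite := by
    intro A hA hfin
    obtain ⟨N, hN, hNO, hinf⟩ := h𝒩 O hO A hA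
    obtain ⟨k, rfl⟩ := hf_surj N (mem_insert_of_mem _ hN) hNO
    exact hinf (hfin k)
  have hU₀ : ⋃ k, f k ∈ 𝓝 x := by
    by_contra hcon
    refine not_acc (⋃ k, f k)ᶜ (accumulates_of_disjoint_ker (fun U hU => ?_) fun a ha hak => ?_)
      fun k => ?_
    · exact inter_compl_nonempty_iff.2 fun hsub => hcon (mem_of_superset hU hsub)
    · obtain ⟨k, hk⟩ := hf_surj _ (mem_insert _ _) hkerO
      exact ha (mem_iUnion.2 ⟨k, hk ▸ hak⟩)
    · rw [(disjoint_compl_right_iff_subset.2 (subset_iUnion f k)).inter_eq]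
      exact finite_empty
  by_contra! hcon
  have hmeet : ∀ U ∈ 𝓝 x,
      (U ∩ {y | ∃ A : Set X, Accumulates A y ∧ ∀ k, (f k ∩ A).Finite}).Nonempty := by
    intro U hU
    obtain ⟨K, hK, hKU, hbad⟩ := hcon _ (inter_mem hU hU₀)
    obtain ⟨y, hyK, hy⟩ := hK.exists_accumulates (hKU.trans inter_subset_right) fun n hn => by
      refine hbad (f '' Iic n) ?_ ((finite_Iic n).image f) (by simpa [sUnion_image] using hn) ?_
      · rintro _ ⟨k, -, rfl⟩
        exact (hf_mem k).1
      · rintro _ ⟨_, ⟨k, -, rfl⟩, ha⟩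
        exact (hf_mem k).2 ha
    exact ⟨y, (hKU hyK).1, hy⟩
  obtain ⟨y, hy, hyU⟩ := h𝒩.exists_seq hc hmeet
  choose A hAacc hAfin using hy
  refine not_acc (⋃ j, A j \ ⋃ i ≤ j, f i) (fun U hU hfin => ?_) fun k => ?_
  · obtain ⟨j, hj⟩ := hyU _ (interior_mem_nhds.2 hU)
    have hbig := hAacc j U (mem_interior_iff_mem_nhds.1 hj)
    refine hbig ((hfin.union ((finite_Iic j).biUnion fun i _ => hAfin j i)).subset ?_)
    rintro a ⟨haU, haA⟩
    by_cases ha : a ∈ ⋃ i ≤ j, f i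
    · obtain ⟨i, hi, hai⟩ := mem_iUnion₂.1 ha
      exact Or.inr (mem_iUnion₂.2 ⟨i, hi, hai, haA⟩)
    · exact Or.inl ⟨haU, mem_iUnion.2 ⟨j, haA, ha⟩⟩
  · refine ((finite_Iio k).biUnion fun j _ => hAfin j k).subset ?_
    rintro a ⟨hak, ha⟩
    obtain ⟨j, haA, hna⟩ := mem_iUnion.1 ha
    refine mem_iUnion₂.2 ⟨j, mem_Iio.2 (not_le.1 fun hkj => hna ?_), hak, haA⟩
    exact mem_iUnion₂.2 ⟨k, hkj, hak⟩

/-- If a topological space has the strong Pytkeev property at `x`, then it has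
countable k-character at `x`. -/
theorem strongPytkeevAt_implies_countable_k_character {X : Type*} [TopologicalSpace X] (x : X)
    (h : StrongPytkeevAt X x) :
    ∃ 𝒩 : Set (Set X), 𝒩.Countable ∧ IsLocalKNetworkAt 𝒩 x := by
  obtain ⟨𝒩, hc, h𝒩⟩ := h
  exact ⟨_, hc.insert _, h𝒩.isLocalKNetworkAt_insert_ker hc⟩
end

section
/- Let p be a free (non-principal) ultrafilter on ℕ and let X = ℕ ∪ {∞} carry the topology in which every point of ℕ is isolated and the neighborhoods of ∞ are exactly the sets containing {∞} ∪ S for some S ∈ p. Then X does not have the Pytkeev property at ∞. -/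
open Set Filter Topology

/-- `X` has the Pytkeev property at `x` if every set accumulating at `x` admits a
countable Pytkeev π-network at `x`, i.e. a countable family of infinite sets such that
every neighborhood of `x` contains a member of the family. -/
def PytkeevAt (X : Type*) [TopologicalSpace X] (x : X) : Prop :=
  ∀ A : Set X, Accumulates A x →
    ∃ 𝒞 : Set (Set X), 𝒞.Countable ∧ (∀ P ∈ 𝒞, P.Infinite) ∧
      ∀ O ∈ 𝓝 x, ∃ P ∈ 𝒞, P ⊆ O

/-- The topology on `ℕ ∪ {∞}` (modelled as `Option ℕ`, with `∞ = none`) in which every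
natural number is isolated and the neighborhoods of `∞` are exactly the sets containing
`{∞} ∪ S` for some `S ∈ p`. A set is open iff, whenever it contains `∞`,
its trace on `ℕ` belongs to the ultrafilter `p`. -/
def ultraTopology (p : Ultrafilter ℕ) : TopologicalSpace (Option ℕ) where
  IsOpen U := none ∈ U → {n : ℕ | some n ∈ U} ∈ p
  isOpen_univ := fun _ => by
    have h : {n : ℕ | some n ∈ (Set.univ : Set (Option ℕ))} = Set.univ := by simp
    rw [h]; exact Filter.univ_mem
  isOpen_inter := fun U V hU hV hmem => by
    have h : {n : ℕ | some n ∈ U ∩ V} = {n : ℕ | some n ∈ U} ∩ {n : ℕ | some n ∈ V} := rfl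
    rw [h]; exact Filter.inter_mem (hU hmem.1) (hV hmem.2)
  isOpen_sUnion := fun S hS hmem => by
    obtain ⟨U, hUS, hU⟩ := hmem
    exact Filter.mem_of_superset (hS U hUS hU) (fun n hn => ⟨U, hUS, hn⟩)

/-- Infinite sets of naturals `Q 0, Q 1, …` admit a strictly increasing transversal. -/
theorem exists_strictMono_forall_mem (Q : ℕ → Set ℕ) (hQ : ∀ k, (Q k).Infinite) :
    ∃ f : ℕ → ℕ, StrictMono f ∧ ∀ k, f k ∈ Q k := by
  choose g hgQ hlt using fun k m => (hQ k).exists_gt m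
  let f : ℕ → ℕ := fun n => Nat.rec (g 0 0) (fun k m => g (k + 1) m) n
  refine ⟨f, strictMono_nat_of_lt_succ fun n => hlt (n + 1) (f n), fun k => ?_⟩
  cases k with
  | zero => exact hgQ 0 0
  | succ k => exact hgQ (k + 1) (f k)

/-- Countably many infinite sets of naturals can be split simultaneously by a single set. -/
theorem exists_forall_not_subset_and_not_subset_compl (Q : ℕ → Set ℕ)
    (hQ : ∀ k, (Q k).Infinite) : ∃ B : Set ℕ, ∀ k, ¬ Q k ⊆ B ∧ ¬ Q k ⊆ Bᶜ := by
  obtain ⟨f, hf, hfQ⟩ := exists_strictMono_forall_mem (fun n => Q (n / 2)) fun n => hQ _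
  refine ⟨Set.range fun k => f (2 * k), fun k => ⟨fun h => ?_, fun h => ?_⟩⟩
  · have hmem : f (2 * k + 1) ∈ Q k := by
      simpa [show (2 * k + 1) / 2 = k by omega] using hfQ (2 * k + 1)
    obtain ⟨j, hj⟩ := h hmem
    have := hf.injective hj
    omega
  · have hmem : f (2 * k) ∈ Q k := by simpa using hfQ (2 * k)
    exact h hmem ⟨k, rfl⟩

theorem mem_nhds_none_ultraTopology_iff (p : Ultrafilter ℕ) (O : Set (Option ℕ)) :
    O ∈ @nhds _ (ultraTopology p) none ↔ none ∈ O ∧ some ⁻¹' O ∈ p := by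
  let _ := ultraTopology p
  refine ⟨fun hO => ?_, fun ⟨hnone, hO⟩ => ?_⟩
  · obtain ⟨U, hUO, hU, hnone⟩ := mem_nhds_iff.1 hO
    exact ⟨hUO hnone, Filter.mem_of_superset (hU hnone) fun n hn => hUO hn⟩
  · exact IsOpen.mem_nhds (show IsOpen O from fun _ => hO) hnone

theorem Set.Infinite.preimage_some {α : Type*} {P : Set (Option α)} (hP : P.Infinite) :
    (some ⁻¹' P).Infinite := fun hfin =>
  hP <| ((hfin.image some).insert none).subset fun x hx => by
    cases x with
    | none => exact Set.mem_insert _ _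
    | some a => exact Set.mem_insert_of_mem _ ⟨a, hx, rfl⟩

/-- For any free ultrafilter `p` on `ℕ`, the space `ℕ ∪ {p}` (with naturals isolated and
neighborhoods of `∞` given by members of `p`) fails the Pytkeev property at `∞`. -/
theorem ultrafilter_space_not_pytkeevAt (p : Ultrafilter ℕ)
    (hfree : ∀ S : Set ℕ, S.Finite → S ∉ p) :
    ¬ @PytkeevAt (Option ℕ) (ultraTopology p) none := by
  let _ := ultraTopology p
  intro h
  have hacc : Accumulates (Set.univ : Set (Option ℕ)) none := by
    intro O hO hfin
    rw [Set.inter_univ] at hfin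
    exact hfree _ (hfin.preimage (Option.some_injective ℕ).injOn)
      ((mem_nhds_none_ultraTopology_iff p O).1 hO).2
  obtain ⟨𝒞, hcount, hinf, hnet⟩ := h _ hacc
  have hne : 𝒞.Nonempty := (hnet _ Filter.univ_mem).imp fun _ hP => hP.1
  obtain ⟨P, rfl⟩ := hcount.exists_eq_range hne
  obtain ⟨B, hB⟩ := exists_forall_not_subset_and_not_subset_compl (fun k => some ⁻¹' P k)
    fun k => (hinf _ ⟨k, rfl⟩).preimage_some
  have hsub : ∀ S ∈ p, ∃ k, some ⁻¹' P k ⊆ S := by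
    intro S hS
    have hpre : some ⁻¹' insert none (some '' S) = S := by ext; simp
    obtain ⟨_, ⟨k, rfl⟩, hk⟩ := hnet (insert none (some '' S))
      ((mem_nhds_none_ultraTopology_iff p _).2 ⟨Set.mem_insert _ _, hpre.symm ▸ hS⟩)
    exact ⟨k, hpre ▸ Set.preimage_mono hk⟩
  rcases p.mem_or_compl_mem B with hBp | hBp
  · obtain ⟨k, hk⟩ := hsub B hBp
    exact (hB k).1 hk
  · obtain ⟨k, hk⟩ := hsub Bᶜ hBp
    exact (hB k).2 hk
end

section
/- Let X be a topological space and x ∈ X. Then X is first countable at x (the neighborhood filter of x has a countable basis) if and only if X has the strong Pytkeev property at x and X has countable fan tightness at x. -/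
open Set Filter Topology

/-- `X` has countable fan tightness at `x`: for every sequence of sets `A n` with
`x ∈ closure (A n)` there exist finite sets `F n ⊆ A n` such that every neighborhood
of `x` meets `F n` for infinitely many `n`. -/
def FanTightnessAt (X : Type*) [TopologicalSpace X] (x : X) : Prop :=
  ∀ A : ℕ → Set X, (∀ n, x ∈ closure (A n)) →
    ∃ F : ℕ → Set X, (∀ n, F n ⊆ A n) ∧ (∀ n, (F n).Finite) ∧
      ∀ O ∈ 𝓝 x, {n : ℕ | (O ∩ F n).Nonempty}.Infinite

/-- A set with `x` in its closure accumulates at `x` if none of its points lies in all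
neighborhoods of `x`. -/
theorem accumulates_of_mem_closure_of_disjoint_ker {X : Type*} [TopologicalSpace X] {x : X}
    {A : Set X} (hA : x ∈ closure A) (hker : Disjoint A (𝓝 x).ker) : Accumulates A x := by
  intro O hO hfin
  have hsep : ∀ y ∈ O ∩ A, ∃ V ∈ 𝓝 x, y ∉ V := by
    rintro y ⟨-, hy⟩
    have hyker := disjoint_left.1 hker hy
    simpa [Filter.mem_ker] using hyker
  choose! V hV hyV using hsep
  have hW : O ∩ ⋂ y ∈ O ∩ A, V y ∈ 𝓝 x :=
    inter_mem hO ((biInter_mem hfin).2 hV)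
  obtain ⟨y, ⟨hyO, hyW⟩, hyA⟩ := mem_closure_iff_nhds.1 hA _ hW
  exact hyV y ⟨hyO, hyA⟩ (mem_iInter₂.1 hyW y ⟨hyO, hyA⟩)

/-- Adding the intersection of all neighborhoods of `x` to the network removes the points that
cannot be separated from `x`, so that no separation axiom is needed. -/
theorem IsPytkeevNetworkAt.exists_finite_sUnion_mem_nhds {X : Type*} [TopologicalSpace X] {x : X}
    {𝒩 : Set (Set X)} (hc : 𝒩.Countable) (h𝒩 : IsPytkeevNetworkAt 𝒩 x)
    (hfan : FanTightnessAt X x) {O : Set X} (hO : O ∈ 𝓝 x) :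
    ∃ T : Set (Set X), T.Finite ∧ T ⊆ insert (𝓝 x).ker 𝒩 ∧ ⋃₀ T ⊆ O ∧ ⋃₀ T ∈ 𝓝 x := by
  obtain ⟨f, hf⟩ : ∃ f : ℕ → Set X, {N ∈ insert (𝓝 x).ker 𝒩 | N ⊆ O} = range f :=
    ((hc.insert _).mono (sep_subset _ _)).exists_eq_range
      ⟨(𝓝 x).ker, mem_insert _ _, fun _ hy => Filter.mem_ker.1 hy O hO⟩
  have hfmem : ∀ n, f n ∈ insert (𝓝 x).ker 𝒩 ∧ f n ⊆ O := fun n =>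
    hf.ge (mem_range_self n)
  obtain ⟨m, hm⟩ : (𝓝 x).ker ∈ range f :=
    hf.le ⟨mem_insert _ _, fun _ hy => Filter.mem_ker.1 hy O hO⟩
  by_contra! hno
  -- Shifting by `m` makes every finite union contain `(𝓝 x).ker`.
  have hcl : ∀ n, x ∈ closure (⋃₀ (f '' Iic (m + n)))ᶜ := by
    intro n
    rw [closure_compl, mem_compl_iff, mem_interior_iff_mem_nhds]
    refine hno _ ((finite_Iic _).image f) ?_ ?_
    · rintro _ ⟨i, -, rfl⟩
      exact (hfmem i).1
    · rintro y ⟨_, ⟨i, -, rfl⟩, hy⟩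
      exact (hfmem i).2 hy
  obtain ⟨F, hFsub, hFfin, hF⟩ := hfan _ hcl
  have hdisj : ∀ n k, k ≤ m + n → Disjoint (F n) (f k) := fun n k hk =>
    disjoint_left.2 fun y hy hyk => hFsub n hy ⟨f k, ⟨k, hk, rfl⟩, hyk⟩
  have hx : x ∈ closure (⋃ n, F n) := mem_closure_iff_nhds.2 fun V hV =>
    let ⟨n, hn⟩ := (hF V hV).nonempty
    hn.mono (inter_subset_inter_right V (subset_iUnion F n))
  have hker : Disjoint (⋃ n, F n) (𝓝 x).ker :=
    disjoint_iUnion_left.2 fun n => hm ▸ hdisj n m (Nat.le_add_right m n)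
  obtain ⟨N, hN, hNO, hinf⟩ :=
    h𝒩 O hO _ (accumulates_of_mem_closure_of_disjoint_ker hx hker)
  obtain ⟨k, rfl⟩ : N ∈ range f := hf.le ⟨mem_insert_of_mem _ hN, hNO⟩
  refine hinf (((finite_Iio k).biUnion fun n _ => hFfin n).subset ?_)
  rintro y ⟨hyk, hy⟩
  obtain ⟨n, hn⟩ := mem_iUnion.1 hy
  refine mem_iUnion₂.2 ⟨n, ?_, hn⟩
  by_contra hkn
  have hle : k ≤ n := not_lt.1 hkn
  exact disjoint_left.1 (hdisj n k (by omega)) hn hyk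

theorem strongPytkeevAt_of_isCountablyGenerated {X : Type*} [TopologicalSpace X] (x : X)
    [(𝓝 x).IsCountablyGenerated] : StrongPytkeevAt X x := by
  obtain ⟨U, hU⟩ := (𝓝 x).exists_antitone_basis
  refine ⟨range U, countable_range U, fun O hO A hA => ?_⟩
  obtain ⟨n, hn⟩ := hU.mem_iff.1 hO
  exact ⟨U n, mem_range_self n, hn, hA _ (hU.mem n)⟩

theorem fanTightnessAt_of_isCountablyGenerated {X : Type*} [TopologicalSpace X] (x : X)
    [(𝓝 x).IsCountablyGenerated] : FanTightnessAt X x := by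
  obtain ⟨U, hU⟩ := (𝓝 x).exists_antitone_basis
  intro A hA
  choose y hyU hyA using fun n => mem_closure_iff_nhds.1 (hA n) (U n) (hU.mem n)
  refine ⟨fun n => {y n}, fun n => singleton_subset_iff.2 (hyA n),
    fun n => finite_singleton _, fun O hO => ?_⟩
  obtain ⟨n, hn⟩ := hU.mem_iff.1 hO
  exact (Set.Ici_infinite n).mono fun k hk => ⟨y k, hn (hU.antitone hk (hyU k)), rfl⟩

/-- A topological space is first countable at `x` if and only if it has the strong Pytkeev
property at `x` and countable fan tightness at `x`. -/
theorem firstCountableAt_iff_strongPytkeevAt_and_fanTightnessAt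
    {X : Type*} [TopologicalSpace X] (x : X) :
    (𝓝 x).IsCountablyGenerated ↔ StrongPytkeevAt X x ∧ FanTightnessAt X x := by
  constructor
  · intro _
    exact ⟨strongPytkeevAt_of_isCountablyGenerated x, fanTightnessAt_of_isCountablyGenerated x⟩
  · rintro ⟨⟨𝒩, hc, h𝒩⟩, hfan⟩
    refine ⟨{B ∈ sUnion '' {T | T.Finite ∧ T ⊆ insert (𝓝 x).ker 𝒩} | B ∈ 𝓝 x},
      ((countable_ofPred_finite_subset (hc.insert _)).image _).mono (sep_subset _ _),
      le_antisymm (le_generate_iff.2 fun _ hB => hB.2) fun O hO => ?_⟩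
    obtain ⟨T, hTfin, hT, hTO, hTx⟩ := h𝒩.exists_finite_sUnion_mem_nhds hc hfan hO
    exact mem_of_superset (mem_generate_of_mem ⟨⟨T, ⟨hTfin, hT⟩, rfl⟩, hTx⟩) hTO
end

section
/- Let X be a topological space and x ∈ X. If X has a countable cs*-network at x and X is Fréchet–Urysohn at x, then X has the strong Pytkeev property at x. -/
open Set Filter Topology

/-- A family `𝒩` of subsets is a cs*-network at `x`: for every neighborhood `O` of `x`
and every sequence converging to `x` there is `N ∈ 𝒩` with `N ⊆ O` containing
infinitely many terms of the sequence. -/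
def IsCsStarNetworkAt {X : Type*} [TopologicalSpace X] (𝒩 : Set (Set X)) (x : X) : Prop :=
  ∀ O ∈ 𝓝 x, ∀ u : ℕ → X, Filter.Tendsto u Filter.atTop (𝓝 x) →
    ∃ N ∈ 𝒩, N ⊆ O ∧ {n : ℕ | u n ∈ N}.Infinite

/-- `X` is Fréchet–Urysohn at `x`: every set whose closure contains `x` contains a
sequence converging to `x`. -/
def FrechetUrysohnAt (X : Type*) [TopologicalSpace X] (x : X) : Prop :=
  ∀ A : Set X, x ∈ closure A →
    ∃ u : ℕ → X, (∀ n, u n ∈ A) ∧ Filter.Tendsto u Filter.atTop (𝓝 x)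

/-- In a space that is Fréchet–Urysohn at `x`, every set accumulating at `x` contains a
finite-to-one sequence converging to `x`. -/
theorem Accumulates.exists_finite_fibers_tendsto {X : Type*} [TopologicalSpace X] {x : X}
    {A : Set X} (hA : Accumulates A x) (hFU : FrechetUrysohnAt X x) :
    ∃ u : ℕ → X, (∀ n, u n ∈ A) ∧ Tendsto u atTop (𝓝 x) ∧ ∀ y, (u ⁻¹' {y}).Finite := by
  by_cases hI : (A ∩ {y | ∀ O ∈ 𝓝 x, y ∈ O}).Infinite
  · refine ⟨fun n => hI.natEmbedding _ n, fun n => (hI.natEmbedding _ n).2.1, ?_, fun y => ?_⟩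
    · exact fun O hO => mem_map.2 (univ_mem' fun n => (hI.natEmbedding _ n).2.2 O hO)
    · exact (finite_singleton y).preimage
        (Subtype.val_injective.comp (hI.natEmbedding _).injective).injOn
  · have hx : x ∈ closure (A \ {y | ∀ O ∈ 𝓝 x, y ∈ O}) := by
      refine mem_closure_iff_nhds.2 fun O hO => ?_
      obtain ⟨y, ⟨hyO, hyA⟩, hy⟩ := (hA O hO).exists_notMem_finite (not_infinite.1 hI)
      exact ⟨y, hyO, hyA, fun h => hy ⟨hyA, h⟩⟩
    obtain ⟨u, huA, hu⟩ := hFU _ hx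
    refine ⟨u, fun n => (huA n).1, hu, fun y => ?_⟩
    by_contra hy
    obtain ⟨m, hm⟩ := Set.Infinite.nonempty hy
    refine (huA m).2 fun O hO => ?_
    obtain ⟨k, hk⟩ := eventually_atTop.1 (hu.eventually_mem hO)
    obtain ⟨n, hn, hkn⟩ := Set.Infinite.exists_gt hy k
    have hmn : u n = u m := hn.trans hm.symm
    exact hmn ▸ hk n hkn.le

/-- If `X` has a countable cs*-network at `x` and is Fréchet–Urysohn at `x`,
then `X` has the strong Pytkeev property at `x`. -/
theorem strongPytkeevAt_of_csStar_frechetUrysohn {X : Type*} [TopologicalSpace X] (x : X)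
    (𝒩 : Set (Set X)) (hcount : 𝒩.Countable) (hcs : IsCsStarNetworkAt 𝒩 x)
    (hFU : FrechetUrysohnAt X x) :
    StrongPytkeevAt X x := by
  refine ⟨𝒩, hcount, fun O hO A hA => ?_⟩
  obtain ⟨u, huA, hu, hfib⟩ := hA.exists_finite_fibers_tendsto hFU
  obtain ⟨N, hN, hNO, hinf⟩ := hcs O hO u hu
  refine ⟨N, hN, hNO, fun hfin => hinf ?_⟩
  exact (hfin.preimage' fun y _ => hfib y).subset fun n hn => ⟨hn, huA n⟩
end

section
/- Let X be a sequential topological space (every sequentially closed subset of X is closed) and x ∈ X a point at which X has a countable local k-network. Then X has the strong Pytkeev property at x. -/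
open Set Filter Topology

/-- The set of points specializing to a given point is compact. -/
theorem isCompact_setOf_specializes {X : Type*} [TopologicalSpace X] (x : X) :
    IsCompact {a : X | a ⤳ x} := by
  intro f hf hle
  refine ⟨x, specializes_rfl, ?_⟩
  have : f ≤ 𝓝 x := fun s hs => hle fun a ha => mem_of_mem_nhds (ha hs)
  exact ClusterPt.of_le_nhds this

/-- If a sequence with finite range converges to `y`, then one of its values specializes
to `y`. -/
theorem exists_specializes_of_tendsto_of_finite_range {X : Type*} [TopologicalSpace X]
    {a : ℕ → X} {y : X} (hfin : (range a).Finite) (ha : Tendsto a atTop (𝓝 y)) :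
    ∃ n, a n ⤳ y := by
  by_contra! hne
  have hev : ∀ᶠ z in 𝓝 y, ∀ b ∈ range a, z ≠ b := by
    refine (eventually_all_finite hfin).2 ?_
    rintro _ ⟨n, rfl⟩
    obtain ⟨s, hs, hns⟩ := Filter.not_le.1 (mt specializes_iff_pure.2 (hne n))
    filter_upwards [hs] with z hz hzn
    exact hns (mem_pure.2 (hzn ▸ hz))
  obtain ⟨n, hn⟩ := (ha.eventually hev).exists
  exact hn (a n) (mem_range_self n) rfl

/-- In a sequential space, if `A` meets every compact subset of a neighborhood of `x` in a
finite set, then `A` does not accumulate at `x`. -/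
theorem not_accumulates_of_finite_inter_isCompact {X : Type*} [TopologicalSpace X]
    [SequentialSpace X] {x : X} {U A : Set X} (hU : U ∈ 𝓝 x)
    (hA : ∀ K : Set X, IsCompact K → K ⊆ U → (K ∩ A).Finite) : ¬ Accumulates A x := by
  wlog hUo : IsOpen U generalizing U
  · obtain ⟨V, hVU, hV, hxV⟩ := mem_nhds_iff.1 hU
    exact this (hV.mem_nhds hxV) (fun K hK hKV => hA K hK (hKV.trans hVU)) hV
  intro hacc
  let C : Set X := {y | y ∈ U → ∃ a ∈ A, ¬ a ⤳ x ∧ a ⤳ y}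
  have hC : IsClosed C := by
    refine IsSeqClosed.isClosed fun u y hu huy hy => ?_
    have hex : ∀ᶠ n in atTop, ∃ a ∈ A, ¬ a ⤳ x ∧ a ⤳ u n :=
      (huy.eventually (hUo.mem_nhds hy)).mono fun n hn => hu n hn
    obtain ⟨N, hN⟩ := eventually_atTop.1 hex
    have : Nonempty X := ⟨x⟩
    choose! a haA hax hau using hN
    have hay : Tendsto a atTop (𝓝 y) := by
      refine tendsto_def.2 fun s hs => ?_
      filter_upwards [huy.eventually (eventually_mem_nhds_iff.2 hs), eventually_ge_atTop N]
        with n hn hNn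
      exact mem_of_mem_nhds (x := a n) (s := s) (hau n hNn hn)
    obtain ⟨M, hM⟩ := eventually_atTop.1 (hay.eventually (hUo.mem_nhds hy))
    let b : ℕ → X := fun n => a (n + (N + M))
    have hby : Tendsto b atTop (𝓝 y) := hay.comp (tendsto_add_atTop_nat (N + M))
    have hbU : insert y (range b) ⊆ U := by
      refine insert_subset hy ?_
      rintro _ ⟨n, rfl⟩
      exact hM _ (by omega)
    have hbfin : (range b).Finite := by
      refine (hA _ hby.isCompact_insert_range hbU).subset ?_
      rintro _ ⟨n, rfl⟩
      exact ⟨mem_insert_of_mem _ (mem_range_self n), haA _ (by omega)⟩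
    obtain ⟨n, hn⟩ := exists_specializes_of_tendsto_of_finite_range hbfin hby
    exact ⟨b n, haA _ (by omega), hax _ (by omega), hn⟩
  have hxC : x ∉ C := fun h => by
    obtain ⟨a, -, hax, hax'⟩ := h (mem_of_mem_nhds hU)
    exact hax hax'
  refine hacc _ (hC.isOpen_compl.mem_nhds hxC) ?_
  refine (hA _ (isCompact_setOf_specializes x) fun a ha => mem_of_mem_nhds (ha hU)).subset ?_
  rintro p ⟨hpC, hpA⟩
  refine ⟨?_, hpA⟩
  by_contra hpx
  exact hpC fun _ => ⟨p, hpA, hpx, specializes_rfl⟩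

/-- A sequential space with a countable local k-network at `x` has the strong Pytkeev
property at `x`. -/
theorem strongPytkeevAt_of_sequential_localKNetwork {X : Type*} [TopologicalSpace X]
    [SequentialSpace X] (x : X)
    (𝒩 : Set (Set X)) (hcount : 𝒩.Countable) (hk : IsLocalKNetworkAt 𝒩 x) :
    StrongPytkeevAt X x := by
  refine ⟨𝒩, hcount, fun O hO A hacc => ?_⟩
  by_contra! hfin
  obtain ⟨U, hU, hUk⟩ := hk O hO
  refine not_accumulates_of_finite_inter_isCompact hU (fun K hK hKU => ?_) hacc
  obtain ⟨ℱ, hℱ, hℱfin, hKℱ, hℱO⟩ := hUk K hK hKU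
  have hunion : (⋃ N ∈ ℱ, N ∩ A).Finite := hℱfin.biUnion fun N hN =>
    hfin N (hℱ hN) ((subset_sUnion_of_mem hN).trans hℱO)
  refine hunion.subset ?_
  rintro p ⟨hpK, hpA⟩
  obtain ⟨N, hN, hpN⟩ := hKℱ hpK
  exact mem_biUnion hN ⟨hpN, hpA⟩
end

section
/- Let X be a k₂-space (for every non-closed set A ⊆ X there exists a compact subset K ⊆ X which is Hausdorff in the subspace topology and such that A ∩ K is not closed in K) and let x ∈ X be a point at which X has a countable local k-network. Then X has the strong Pytkeev property at x. -/
open Set Filter Topology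

/-- `X` is a k₂-space: for every non-closed set `A ⊆ X` there is a compact set `K`,
Hausdorff in the subspace topology, such that `A ∩ K` is not closed in `K`. -/
def IsK2Space (X : Type*) [TopologicalSpace X] : Prop :=
  ∀ A : Set X, ¬ IsClosed A → ∃ K : Set X, IsCompact K ∧ T2Space ↥K ∧
    ¬ IsClosed (Subtype.val ⁻¹' A : Set ↥K)

/-- In a k₂-space, if a set meets every compact subset of an open set `V` in a finite set,
then it does not accumulate at any point of `V`. -/
lemma IsK2Space.not_accumulates_of_forall_isCompact {X : Type*} [TopologicalSpace X]
    (hk2 : IsK2Space X) {V A : Set X} (hV : IsOpen V)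
    (hfin : ∀ K : Set X, IsCompact K → K ⊆ V → (K ∩ A).Finite) {x : X} (hx : x ∈ V) :
    ¬ Accumulates A x := by
  intro hA
  have hF : ¬ IsClosed (Vᶜ ∪ A \ {x}) := by
    intro hF
    have hmem : (Vᶜ ∪ A \ {x})ᶜ ∈ 𝓝 x := hF.isOpen_compl.mem_nhds (by simp [hx])
    refine hA _ hmem ((finite_singleton x).subset ?_)
    rintro y ⟨hy, hyA⟩
    by_contra hyx
    exact hy (Or.inr ⟨hyA, hyx⟩)
  obtain ⟨K, hK, _, hKF⟩ := hk2 _ hF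
  have : CompactSpace K := isCompact_iff_compactSpace.mp hK
  rw [← closure_subset_iff_isClosed, not_subset] at hKF
  obtain ⟨z, hz, hzF⟩ := hKF
  have hzV : z.1 ∈ V := by
    by_contra h
    exact hzF (Or.inl h)
  obtain ⟨C, hCz, hCV, hC⟩ :=
    local_compact_nhds ((hV.preimage continuous_subtype_val).mem_nhds hzV)
  have hTfin : (C ∩ Subtype.val ⁻¹' (A \ {x})).Finite := by
    refine Finite.of_finite_image ?_ Subtype.val_injective.injOn
    refine (hfin _ (hC.image continuous_subtype_val) (image_subset_iff.mpr hCV)).subset ?_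
    rintro _ ⟨y, hy, rfl⟩
    exact ⟨mem_image_of_mem _ hy.1, hy.2.1⟩
  have hTz : (C ∩ Subtype.val ⁻¹' (A \ {x}))ᶜ ∈ 𝓝 z :=
    hTfin.isClosed.isOpen_compl.mem_nhds fun h => hzF (Or.inr h.2)
  obtain ⟨y, ⟨hyC, hyT⟩, hyF⟩ := mem_closure_iff_nhds.mp hz _ (inter_mem hCz hTz)
  rcases hyF with hyV | hyA
  · exact hyV (hCV hyC)
  · exact hyT ⟨hyC, hyA⟩

/-- A k₂-space with a countable local k-network at `x` has the strong Pytkeev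
property at `x`. -/
theorem strongPytkeevAt_of_k2_localKNetwork {X : Type*} [TopologicalSpace X]
    (hk2 : IsK2Space X) (x : X)
    (𝒩 : Set (Set X)) (hcount : 𝒩.Countable) (hk : IsLocalKNetworkAt 𝒩 x) :
    StrongPytkeevAt X x := by
  refine ⟨𝒩, hcount, fun O hO A hA => ?_⟩
  by_contra! hfin
  obtain ⟨U, hU, hUO⟩ := hk O hO
  refine hk2.not_accumulates_of_forall_isCompact isOpen_interior (fun K hK hKU => ?_)
    (mem_interior_iff_mem_nhds.mpr hU) hA
  obtain ⟨ℱ, hℱ𝒩, hℱ, hKℱ, hℱO⟩ := hUO K hK (hKU.trans interior_subset)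
  refine (hℱ.biUnion fun N hN =>
    hfin N (hℱ𝒩 hN) ((subset_sUnion_of_mem hN).trans hℱO)).subset ?_
  rintro y ⟨hyK, hyA⟩
  obtain ⟨N, hN, hyN⟩ := hKℱ hyK
  exact mem_biUnion hN ⟨hyN, hyA⟩
end

section
/- Let X be a Hausdorff topological space with a countable k-network, let 𝓘 be a discretely-complete ideal of compact subsets of X, and let Y be a topological space with the strong Pytkeev property at a point y₀ ∈ Y. Then the set C(X,Y) of continuous maps from X to Y, endowed with the 𝓘-open topology, has the strong Pytkeev property at the constant function with value y₀. -/
open Set Filter Topology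

/-- A family `𝒩` of subsets of `X` is a k-network: for every open `U` and compact
`K ⊆ U` there is a finite subfamily `ℱ ⊆ 𝒩` with `K ⊆ ⋃₀ ℱ ⊆ U`. -/
def IsKNetwork {X : Type*} [TopologicalSpace X] (𝒩 : Set (Set X)) : Prop :=
  ∀ U : Set X, IsOpen U → ∀ K : Set X, IsCompact K → K ⊆ U →
    ∃ ℱ ⊆ 𝒩, ℱ.Finite ∧ K ⊆ ⋃₀ ℱ ∧ ⋃₀ ℱ ⊆ U

/-- A family `𝓘` of compact subsets of `X` is an ideal of compact sets. -/
def IsCompactIdeal {X : Type*} [TopologicalSpace X] (𝓘 : Set (Set X)) : Prop :=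
  (∀ K ∈ 𝓘, IsCompact K) ∧ ⋃₀ 𝓘 = Set.univ ∧
    (∀ A ∈ 𝓘, ∀ B ∈ 𝓘, A ∪ B ∈ 𝓘) ∧
    (∀ A ∈ 𝓘, ∀ K : Set X, IsCompact K → A ∩ K ∈ 𝓘)

/-- An ideal `𝓘` of compact sets is discretely-complete: for compact `A, B ⊆ X` such that
`A \ B` is a countable discrete subspace of `X`, `B ∈ 𝓘` implies `A ∈ 𝓘`. -/
def DiscretelyComplete {X : Type*} [TopologicalSpace X] (𝓘 : Set (Set X)) : Prop :=
  ∀ A B : Set X, IsCompact A → IsCompact B → (A \ B).Countable →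
    DiscreteTopology ↥(A \ B) → B ∈ 𝓘 → A ∈ 𝓘

/-- The `𝓘`-open topology on `C(X, Y)`, generated by the subbasic sets
`[K; U] = {f | f(K) ⊆ U}` for `K ∈ 𝓘` and `U` open in `Y`. -/
def idealOpenTopology {X Y : Type*} [TopologicalSpace X] [TopologicalSpace Y]
    (𝓘 : Set (Set X)) : TopologicalSpace C(X, Y) :=
  TopologicalSpace.generateFrom
    {S : Set C(X, Y) | ∃ K ∈ 𝓘, ∃ U : Set Y, IsOpen U ∧ S = {f : C(X, Y) | Set.MapsTo (⇑f) K U}}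

section FunctionSpaceNeighborhoods

variable {X Y : Type*} [TopologicalSpace X] [TopologicalSpace Y] {𝓘 : Set (Set X)} {y₀ : Y}

theorem setOf_mapsTo_mem_nhds_const {K : Set X} (hK : K ∈ 𝓘) {O : Set Y} (hO : O ∈ 𝓝 y₀) :
    {f : C(X, Y) | MapsTo f K O} ∈ @nhds _ (idealOpenTopology 𝓘) (ContinuousMap.const X y₀) := by
  let _ : TopologicalSpace C(X, Y) := idealOpenTopology 𝓘
  obtain ⟨V, hVO, hV, hyV⟩ := mem_nhds_iff.1 hO
  refine mem_nhds_iff.2 ⟨{f : C(X, Y) | MapsTo f K V}, fun f hf => hf.mono_right hVO,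
    TopologicalSpace.GenerateOpen.basic _ ⟨K, hK, V, hV, rfl⟩, fun _ _ => hyV⟩

theorem exists_setOf_mapsTo_subset_of_mem_nhds_const (hne : 𝓘.Nonempty)
    (hunion : ∀ A ∈ 𝓘, ∀ B ∈ 𝓘, A ∪ B ∈ 𝓘) {W : Set C(X, Y)}
    (hW : W ∈ @nhds _ (idealOpenTopology 𝓘) (ContinuousMap.const X y₀)) :
    ∃ K ∈ 𝓘, ∃ U ∈ 𝓝 y₀, {f : C(X, Y) | MapsTo f K U} ⊆ W := by
  obtain ⟨V, hVW, hV, hyV⟩ :=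
    (@mem_nhds_iff _ (idealOpenTopology 𝓘) (ContinuousMap.const X y₀) W).1 hW
  suffices h : ∃ K ∈ 𝓘, ∃ U ∈ 𝓝 y₀, {f : C(X, Y) | MapsTo f K U} ⊆ V by
    obtain ⟨K, hK, U, hU, h⟩ := h
    exact ⟨K, hK, U, hU, h.trans hVW⟩
  clear hVW hW
  change TopologicalSpace.GenerateOpen _ V at hV
  obtain ⟨K₀, hK₀⟩ := hne
  induction hV with
  | basic S hS =>
    obtain ⟨K, hK, U, hU, rfl⟩ := hS
    rcases K.eq_empty_or_nonempty with rfl | ⟨x, hx⟩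
    · exact ⟨K₀, hK₀, univ, univ_mem, fun f _ => mapsTo_empty f U⟩
    · exact ⟨K, hK, U, hU.mem_nhds (hyV hx), subset_rfl⟩
  | univ => exact ⟨K₀, hK₀, univ, univ_mem, subset_univ _⟩
  | inter S T _ _ ihS ihT =>
    obtain ⟨K, hK, U, hU, hS⟩ := ihS hyV.1
    obtain ⟨L, hL, V, hV, hT⟩ := ihT hyV.2
    exact ⟨K ∪ L, hunion K hK L hL, U ∩ V, inter_mem hU hV, fun f hf =>
      ⟨hS fun x hx => (hf (Or.inl hx)).1, hT fun x hx => (hf (Or.inr hx)).2⟩⟩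
  | sUnion 𝒮 _ ih =>
    obtain ⟨S, hS, hyS⟩ := hyV
    obtain ⟨K, hK, U, hU, h⟩ := ih S hS hyS
    exact ⟨K, hK, U, hU, h.trans (subset_sUnion_of_mem hS)⟩

end FunctionSpaceNeighborhoods

section CompactSets

variable {X : Type*}

/-- The finite intersections of finite unions of members of a family. -/
def finiteInterUnions (𝒦 : Set (Set X)) : Set (Set X) :=
  sInter '' {𝒢 | 𝒢.Finite ∧ 𝒢 ⊆ sUnion '' {ℱ | ℱ.Finite ∧ ℱ ⊆ 𝒦}}

theorem countable_finiteInterUnions {𝒦 : Set (Set X)} (h𝒦 : 𝒦.Countable) :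
    (finiteInterUnions 𝒦).Countable :=
  (countable_ofPred_finite_subset ((countable_ofPred_finite_subset h𝒦).image _)).image _

variable [TopologicalSpace X]

theorem IsKNetwork.exists_antitone_seq {𝒦 : Set (Set X)} (hknet : IsKNetwork 𝒦)
    (h𝒦 : 𝒦.Countable) {C : Set X} (hC : IsCompact C) :
    ∃ K : ℕ → Set X, Antitone K ∧ (∀ n, K n ∈ finiteInterUnions 𝒦) ∧ (∀ n, C ⊆ K n) ∧
      ∀ V ∈ 𝓝ˢ C, ∃ n, K n ⊆ V := by
  let 𝒰 : Set (Set X) := {E ∈ sUnion '' {ℱ | ℱ.Finite ∧ ℱ ⊆ 𝒦} | C ⊆ E}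
  have hcount : 𝒰.Countable :=
    ((countable_ofPred_finite_subset h𝒦).image _).mono (sep_subset _ _)
  have hmem : ∀ V, IsOpen V → C ⊆ V → ∃ E ∈ 𝒰, E ⊆ V := fun V hV hCV => by
    obtain ⟨ℱ, hℱ, hfin, hCℱ, hℱV⟩ := hknet V hV C hC hCV
    exact ⟨⋃₀ ℱ, ⟨⟨ℱ, ⟨hfin, hℱ⟩, rfl⟩, hCℱ⟩, hℱV⟩
  obtain ⟨E₀, hE₀, -⟩ := hmem univ isOpen_univ (subset_univ C)
  obtain ⟨e, he⟩ := hcount.exists_eq_range ⟨E₀, hE₀⟩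
  have heU : ∀ n, e n ∈ 𝒰 := fun n => he ▸ mem_range_self n
  refine ⟨fun n => ⋂₀ (e '' Iic n), fun m n hmn => sInter_subset_sInter
    (image_mono (Iic_subset_Iic.2 hmn)), fun n => ⟨_, ⟨(finite_Iic n).image e, ?_⟩, rfl⟩, ?_, ?_⟩
  · rintro _ ⟨i, -, rfl⟩
    exact (heU i).1
  · rintro n x hx _ ⟨i, -, rfl⟩
    exact (heU i).2 hx
  · intro V hV
    obtain ⟨V', hV', hCV', hV'V⟩ := mem_nhdsSet_iff_exists.1 hV
    obtain ⟨E, hE, hEV⟩ := hmem V' hV' hCV'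
    rw [he] at hE
    obtain ⟨n, rfl⟩ := hE
    exact ⟨n, (sInter_subset_of_mem (mem_image_of_mem e self_mem_Iic)).trans (hEV.trans hV'V)⟩

theorem IsCompact.of_finite_diff_nhdsSet {C D : Set X} (hC : IsCompact C) (hCD : C ⊆ D)
    (h : ∀ V ∈ 𝓝ˢ C, (D \ V).Finite) : IsCompact D := by
  intro l hl hlD
  by_cases hcl : ∃ c ∈ C, ClusterPt c l
  · obtain ⟨c, hc, hcl⟩ := hcl
    exact ⟨c, hCD hc, hcl⟩
  · push Not at hcl
    have hdisj : Disjoint (𝓝ˢ C) l :=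
      hC.disjoint_nhdsSet_left.2 fun c hc => by
        rw [disjoint_iff, ← not_neBot]
        exact hcl c hc
    obtain ⟨V, hV, T, hT, hVT⟩ := Filter.disjoint_iff.1 hdisj
    have hle : l ≤ 𝓟 (D \ V) := le_principal_iff.2 <| by
      filter_upwards [le_principal_iff.1 hlD, hT] with x hx hxT
      exact ⟨hx, disjoint_right.1 hVT hxT⟩
    obtain ⟨x, hx, hxl⟩ := (h V hV).isCompact hle
    exact ⟨x, hx.1, hxl⟩

theorem discreteTopology_diff_of_finite_diff_nhdsSet [T2Space X] {C D : Set X}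
    (hC : IsCompact C) (h : ∀ V ∈ 𝓝ˢ C, (D \ V).Finite) : DiscreteTopology ↥(D \ C) := by
  rw [discreteTopology_subtype_iff]
  intro x hx
  obtain ⟨V, G, hV, hG, hCV, hxG, hVG⟩ :=
    SeparatedNhds.of_isCompact_isCompact hC (isCompact_singleton (x := x))
      (disjoint_singleton_right.2 hx.2)
  have hfin : ((D \ V) \ {x}).Finite := (h V (hV.mem_nhdsSet.2 hCV)).sdiff
  have hO : G ∩ ((D \ V) \ {x})ᶜ ∈ 𝓝 x :=
    inter_mem (hG.mem_nhds (hxG rfl)) (hfin.isClosed.isOpen_compl.mem_nhds fun hx' => hx'.2 rfl)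
  rw [← empty_mem_iff_bot]
  filter_upwards [mem_inf_of_left (mem_nhdsWithin_of_mem_nhds hO),
    mem_inf_of_left self_mem_nhdsWithin, mem_inf_of_right (mem_principal_self (D \ C))]
    with z hz hzx hzD
  exact hz.2 ⟨⟨hzD.1, fun hzV => disjoint_left.1 hVG hzV hz.1⟩, hzx⟩

theorem DiscretelyComplete.union_range_mem [T2Space X] {𝓘 : Set (Set X)}
    (hdc : DiscretelyComplete 𝓘) {C : Set X} (hCI : C ∈ 𝓘) (hC : IsCompact C)
    {ι : Type*} [Countable ι] {x : ι → X} (hx : Tendsto x cofinite (𝓝ˢ C)) :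
    C ∪ range x ∈ 𝓘 := by
  have hfin : ∀ V ∈ 𝓝ˢ C, ((C ∪ range x) \ V).Finite := fun V hV => by
    have hVfin : {i | x i ∉ V}.Finite := hx hV
    refine (hVfin.image x).subset ?_
    rintro _ ⟨hz | ⟨i, rfl⟩, hzV⟩
    · exact absurd (subset_of_mem_nhdsSet hV hz) hzV
    · exact ⟨i, hzV, rfl⟩
  refine hdc _ C (hC.of_finite_diff_nhdsSet subset_union_left hfin) hC
    ((countable_range x).mono ?_) (discreteTopology_diff_of_finite_diff_nhdsSet hC hfin) hCI
  rintro z ⟨hz | hz, hzC⟩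
  exacts [absurd hz hzC, hz]

theorem IsCompact.exists_mapClusterPt_of_tendsto_nhdsSet {ι : Type*} {l : Filter ι} [l.NeBot]
    {C : Set X} (hC : IsCompact C) {x : ι → X} (hx : Tendsto x l (𝓝ˢ C)) :
    ∃ c ∈ C, MapClusterPt c l x := by
  by_contra! h
  have hdisj : Disjoint (𝓝ˢ C) (map x l) := hC.disjoint_nhdsSet_left.2 fun c hc => by
    rw [disjoint_iff, ← not_neBot]
    exact h c hc
  exact (map_neBot (f := l) (m := x)).ne (disjoint_self.1 (hdisj.mono_left hx))

theorem tendsto_nhdsSet_of_antitone {C : Set X} {K : ℕ → Set X} (hK : Antitone K)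
    (hKnhds : ∀ V ∈ 𝓝ˢ C, ∃ n, K n ⊆ V) {ι : Type*} {l : Filter ι} {x : ι → X} {n : ι → ℕ}
    (hn : Tendsto n l atTop) (hx : ∀ i, x i ∈ K (n i)) : Tendsto x l (𝓝ˢ C) := by
  intro V hV
  obtain ⟨m, hm⟩ := hKnhds V hV
  exact (hn.eventually_ge_atTop m).mono fun i hi => hm (hK hi (hx i))

end CompactSets

section PytkeevNetworks

variable {Y : Type*} [TopologicalSpace Y] {y₀ : Y}

theorem accumulates_range_of_forall_notMem_ker {ι : Type*} {y : ι → Y}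
    (hy : ∀ i, y i ∉ (𝓝 y₀).ker) (h : ∀ O ∈ 𝓝 y₀, ∃ i, y i ∈ O) :
    Accumulates (range y) y₀ := by
  intro O hO hfin
  have hO' : ∀ z ∈ O ∩ range y, ({z}ᶜ : Set Y) ∈ 𝓝 y₀ := by
    rintro _ ⟨-, i, rfl⟩
    have := hy i
    rw [mem_ker] at this
    push Not at this
    obtain ⟨s, hs, his⟩ := this
    exact mem_of_superset hs fun w hw hwi => his (hwi ▸ hw)
  obtain ⟨i, hiO, hi⟩ := h _ (inter_mem hO ((biInter_mem hfin).2 hO'))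
  exact mem_iInter₂.1 hi (y i) ⟨hiO, i, rfl⟩ rfl

theorem IsPytkeevNetworkAt.exists_seq_s6 {𝒬 : Set (Set Y)} (h𝒬 : IsPytkeevNetworkAt 𝒬 y₀)
    (hcount : 𝒬.Countable) {ι : Type*} {y : ι → Y} (h : ∀ O ∈ 𝓝 y₀, ∃ i, y i ∈ O) :
    ∃ u : ℕ → ι, ∀ O ∈ 𝓝 y₀, ∃ k, y (u k) ∈ O := by
  by_cases hker : ∃ i, y i ∈ (𝓝 y₀).ker
  · obtain ⟨i, hi⟩ := hker
    exact ⟨fun _ => i, fun O hO => ⟨0, mem_ker.1 hi O hO⟩⟩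
  push Not at hker
  have hacc := accumulates_range_of_forall_notMem_ker hker h
  obtain ⟨i₀, -⟩ := h univ univ_mem
  obtain ⟨N, hN, -⟩ := h𝒬 univ univ_mem _ hacc
  obtain ⟨e, rfl⟩ := hcount.exists_eq_range ⟨N, hN⟩
  have hchoose : ∀ k, ∃ i, (∃ j, y j ∈ e k) → y i ∈ e k := fun k => by
    by_cases hk : ∃ j, y j ∈ e k
    · exact hk.imp fun j hj _ => hj
    · exact ⟨i₀, fun hk' => absurd hk' hk⟩
  choose u hu using hchoose
  refine ⟨u, fun O hO => ?_⟩
  obtain ⟨_, ⟨k, rfl⟩, hkO, hinf⟩ := h𝒬 O hO _ hacc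
  obtain ⟨_, hz, j, rfl⟩ := hinf.nonempty
  exact ⟨k, hkO (hu k ⟨j, hz⟩)⟩

/-- The finite unions of members of `𝒬` and of the intersection of all neighborhoods of `y₀`. -/
def finiteUnionsWithKer (𝒬 : Set (Set Y)) (y₀ : Y) : Set (Set Y) :=
  sUnion '' {ℱ | ℱ.Finite ∧ ℱ ⊆ insert (𝓝 y₀).ker 𝒬}

theorem countable_finiteUnionsWithKer {𝒬 : Set (Set Y)} (h𝒬 : 𝒬.Countable) :
    (finiteUnionsWithKer 𝒬 y₀).Countable :=
  (countable_ofPred_finite_subset (h𝒬.insert _)).image _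

theorem exists_monotone_seq_finiteUnionsWithKer {𝒬 : Set (Set Y)} (h𝒬 : 𝒬.Countable)
    {U : Set Y} (hU : U ∈ 𝓝 y₀) :
    ∃ P : ℕ → Set Y, Monotone P ∧ (∀ n, P n ∈ finiteUnionsWithKer 𝒬 y₀) ∧ (∀ n, P n ⊆ U) ∧
      (∀ n, (𝓝 y₀).ker ⊆ P n) ∧ ∀ Q ∈ 𝒬, Q ⊆ U → ∃ n, Q ⊆ P n := by
  have hker : (𝓝 y₀).ker ⊆ U := fun z hz => mem_ker.1 hz U hU
  obtain ⟨e, he⟩ := ((h𝒬.insert (𝓝 y₀).ker).mono (sep_subset _ (· ⊆ U))).exists_eq_range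
    ⟨(𝓝 y₀).ker, mem_insert _ _, hker⟩
  have heU : ∀ n, e n ∈ {Q ∈ insert (𝓝 y₀).ker 𝒬 | Q ⊆ U} := fun n => he ▸ mem_range_self n
  refine ⟨fun n => ⋃₀ insert (𝓝 y₀).ker (e '' Iic n), fun m n hmn => sUnion_subset_sUnion
    (insert_subset_insert (image_mono (Iic_subset_Iic.2 hmn))),
    fun n => ⟨_, ⟨((finite_Iic n).image e).insert _, insert_subset (mem_insert _ _) ?_⟩, rfl⟩,
    fun n => sUnion_subset ?_, fun n => subset_sUnion_of_mem (mem_insert _ _), ?_⟩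
  · rintro _ ⟨i, -, rfl⟩
    exact (heU i).1
  · rintro _ (rfl | ⟨i, -, rfl⟩)
    exacts [hker, (heU i).2]
  · intro Q hQ hQU
    have hQe : Q ∈ range e := he ▸ ⟨mem_insert_of_mem _ hQ, hQU⟩
    obtain ⟨n, rfl⟩ := hQe
    exact ⟨n, subset_sUnion_of_mem (mem_insert_of_mem _ ⟨n, self_mem_Iic, rfl⟩)⟩

theorem IsPytkeevNetworkAt.exists_nhds_forall_notMem {𝒬 : Set (Set Y)}
    (h𝒬 : IsPytkeevNetworkAt 𝒬 y₀) {U : Set Y} (hU : U ∈ 𝓝 y₀) {P : ℕ → Set Y}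
    (hmono : Monotone P) (hker : ∀ n, (𝓝 y₀).ker ⊆ P n) (hP : ∀ Q ∈ 𝒬, Q ⊆ U → ∃ n, Q ⊆ P n)
    {ι : Type*} {y : ι → Y} {n : ι → ℕ} (hn : Tendsto n cofinite atTop)
    (hy : ∀ i, y i ∉ P (n i)) : ∃ O ∈ 𝓝 y₀, ∀ i, y i ∉ O := by
  by_contra! h
  obtain ⟨Q, hQ, hQU, hinf⟩ := h𝒬 U hU _
    (accumulates_range_of_forall_notMem_ker (fun i hi => hy i (hker _ hi)) h)
  obtain ⟨m, hm⟩ := hP Q hQ hQU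
  have hfin : {i | ¬ m ≤ n i}.Finite := hn.eventually_ge_atTop m
  refine hinf ((hfin.image y).subset ?_)
  rintro _ ⟨hz, i, rfl⟩
  exact ⟨i, fun hmi => hy i (hmono hmi (hm hz)), rfl⟩

end PytkeevNetworks

/-- For a Hausdorff space `X` with a countable k-network, a discretely-complete ideal `𝓘`
of compact subsets of `X`, and a space `Y` with the strong Pytkeev property at `y₀`,
the space `C(X,Y)` with the `𝓘`-open topology has the strong Pytkeev property
at the constant function with value `y₀`. -/
theorem strongPytkeevAt_idealOpenTopology {X Y : Type*} [TopologicalSpace X] [T2Space X]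
    [TopologicalSpace Y]
    (𝒦 : Set (Set X)) (h𝒦 : 𝒦.Countable) (hknet : IsKNetwork 𝒦)
    (𝓘 : Set (Set X)) (hideal : IsCompactIdeal 𝓘) (hdc : DiscretelyComplete 𝓘)
    (y₀ : Y) (hY : StrongPytkeevAt Y y₀) :
    @StrongPytkeevAt C(X, Y) (idealOpenTopology 𝓘) (ContinuousMap.const X y₀) := by
  obtain ⟨𝒬, hcount, h𝒬⟩ := hY
  obtain ⟨hcompact, hcover, hunion, -⟩ := hideal
  refine ⟨image2 (fun K P => {f : C(X, Y) | MapsTo f K P}) (finiteInterUnions 𝒦)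
    (finiteUnionsWithKer 𝒬 y₀), (countable_finiteInterUnions h𝒦).image2
    (countable_finiteUnionsWithKer hcount) _, ?_⟩
  intro W hW A hA
  rcases isEmpty_or_nonempty X with hX | ⟨⟨x₀⟩⟩
  · exact absurd (toFinite _) (hA W hW)
  obtain ⟨K₀, hK₀, -⟩ := mem_sUnion.1 (hcover ▸ mem_univ x₀)
  obtain ⟨C, hCI, U, hU, hCU⟩ :=
    exists_setOf_mapsTo_subset_of_mem_nhds_const ⟨K₀, hK₀⟩ hunion hW
  have hC := hcompact C hCI
  obtain ⟨K, hKanti, hKmem, hCK, hKnhds⟩ := hknet.exists_antitone_seq h𝒦 hC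
  obtain ⟨P, hPmono, hPmem, hPU, hPker, hPabs⟩ :=
    exists_monotone_seq_finiteUnionsWithKer hcount hU
  by_contra! hfinite
  have hfin : ∀ n, ({f : C(X, Y) | MapsTo f (K n) (P n)} ∩ A).Finite := fun n =>
    hfinite _ (mem_image2_of_mem (hKmem n) (hPmem n)) fun f hf =>
      hCU (hf.mono (hCK n) (hPU n))
  have hmapsTo : ∀ f : C(X, Y), ∀ m n, m ≤ n → MapsTo f (K m) (P m) → MapsTo f (K n) (P n) :=
    fun f m n hmn hf => hf.mono (hKanti hmn) (hPmono hmn)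
  obtain ⟨D, hDI, O, hO, hDO⟩ : ∃ D ∈ 𝓘, ∃ O ∈ 𝓝 y₀, ∀ f ∈ A, (∃ n, MapsTo f (K n) (P n)) →
      ¬ MapsTo f (K 0) (P 0) → ¬ MapsTo f D O := by
    let ι := {f : C(X, Y) // f ∈ A ∧ (∃ n, MapsTo f (K n) (P n)) ∧ ¬ MapsTo f (K 0) (P 0)}
    have hιcount : Countable ι := by
      refine ((countable_iUnion fun n => (hfin n).countable).mono ?_).to_subtype
      rintro f ⟨hfA, ⟨n, hn⟩, -⟩
      exact mem_iUnion.2 ⟨n, hn, hfA⟩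
    have hstep : ∀ f : ι, ∃ n, ¬ MapsTo f.1 (K n) (P n) ∧ MapsTo f.1 (K (n + 1)) (P (n + 1)) := by
      rintro ⟨f, -, ⟨n, hn⟩, h0⟩
      by_contra! h
      exact Nat.rec h0 h n hn
    choose n hn hn' using hstep
    have hx : ∀ f : ι, ∃ x ∈ K (n f), f.1 x ∉ P (n f) := fun f => by
      simpa [MapsTo] using hn f
    choose x hxK hxP using hx
    have hntendsto : Tendsto n cofinite atTop := tendsto_atTop.2 fun m => by
      refine ((hfin m).preimage Subtype.val_injective.injOn).subset fun f hf => ?_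
      exact ⟨hmapsTo _ _ _ (Nat.succ_le_of_lt (not_le.1 hf)) (hn' f), f.2.1⟩
    obtain ⟨O, hO, hxO⟩ := h𝒬.exists_nhds_forall_notMem hU hPmono hPker hPabs hntendsto hxP
    exact ⟨C ∪ range x, hdc.union_range_mem hCI hC
      (tendsto_nhdsSet_of_antitone hKanti hKnhds hntendsto hxK), O, hO, fun f hfA hf hf0 hfO =>
      hxO ⟨f, hfA, hf, hf0⟩ (hfO (Or.inr (mem_range_self _)))⟩
  obtain ⟨O', hO', hCO'⟩ : ∃ O ∈ 𝓝 y₀, ∀ f ∈ A, (∀ n, ¬ MapsTo f (K n) (P n)) →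
      ¬ MapsTo f C O := by
    by_contra! h
    let ι := {f : C(X, Y) // f ∈ A ∧ ∀ n, ¬ MapsTo f (K n) (P n)}
    have hx : ∀ (f : ι) n, ∃ x ∈ K n, f.1 x ∉ P n := fun f n => by
      simpa [MapsTo] using f.2.2 n
    choose x hxK hxP using hx
    have hcluster : ∀ f : ι, ∃ c ∈ C, MapClusterPt c atTop (x f) := fun f =>
      hC.exists_mapClusterPt_of_tendsto_nhdsSet
        (tendsto_nhdsSet_of_antitone hKanti hKnhds tendsto_id (hxK f))
    choose c hcC hc using hcluster
    obtain ⟨u, hu⟩ := h𝒬.exists_seq_s6 hcount (y := fun f : ι => f.1 (c f)) fun O hO => by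
      obtain ⟨f, hfA, hf, hfO⟩ := h O hO
      exact ⟨⟨f, hfA, hf⟩, hfO (hcC _)⟩
    have hntendsto : Tendsto (fun p : ℕ × ℕ => p.1 + p.2) cofinite atTop :=
      tendsto_atTop.2 fun m => by
        refine ((finite_Iio m).prod (finite_Iio m)).subset fun p hp => ?_
        have : p.1 + p.2 < m := not_le.1 hp
        exact ⟨mem_Iio.2 (by lia), mem_Iio.2 (by lia)⟩
    obtain ⟨O, hO, hxO⟩ := h𝒬.exists_nhds_forall_notMem hU hPmono hPker hPabs hntendsto
      (y := fun p => (u p.1).1 (x (u p.1) (p.1 + p.2))) fun p => hxP _ _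
    obtain ⟨V, hVO, hV, hyV⟩ := mem_nhds_iff.1 hO
    obtain ⟨k, hk⟩ := hu V (hV.mem_nhds hyV)
    obtain ⟨n, hkn, hn⟩ := frequently_atTop.1
      ((hc (u k)).frequently ((hV.preimage (u k).1.continuous).mem_nhds hk)) k
    obtain ⟨j, rfl⟩ := Nat.exists_eq_add_of_le hkn
    exact hxO (k, j) (hVO hn)
  refine hA _ ((@inter_mem_iff _ (@nhds _ (idealOpenTopology 𝓘) _) _ _).2
    ⟨setOf_mapsTo_mem_nhds_const hDI hO, setOf_mapsTo_mem_nhds_const hCI hO'⟩)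
    ((hfin 0).subset ?_)
  rintro f ⟨⟨hfD, hfC⟩, hfA⟩
  refine ⟨?_, hfA⟩
  by_contra hf0
  by_cases hf : ∃ n, MapsTo f (K n) (P n)
  · exact hDO f hfA hf hf0 hfD
  · exact hCO' f hfA (not_exists.1 hf) hfC
end

section
/- Let (X_n)_{n∈ℕ} be topological spaces and let *_n ∈ X_n be points such that each X_n has the strong Pytkeev property at *_n. Then the Tychonoff product ∏_{n∈ℕ} X_n (with the product topology) has the strong Pytkeev property at the point (*_n)_{n∈ℕ}. -/
open Set Filter Topology

/-- If a set accumulating at `x` is covered by finitely many sets, one of them accumulates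
at `x`. -/
theorem Accumulates.exists_of_subset_iUnion {X ι : Type*} [TopologicalSpace X] [Finite ι]
    {x : X} {A : Set X} {B : ι → Set X} (hA : Accumulates A x) (hAB : A ⊆ ⋃ i, B i) :
    ∃ i, Accumulates (B i) x := by
  by_contra! hB
  have hB' : ∀ i, ∃ O ∈ 𝓝 x, (O ∩ B i).Finite := fun i ↦ by
    simpa [Accumulates] using hB i
  choose O hO hfin using hB'
  refine hA (⋂ i, O i) (iInter_mem.2 hO) ((finite_iUnion hfin).subset ?_)
  rintro y ⟨hyO, hyA⟩
  obtain ⟨i, hi⟩ := mem_iUnion.1 (hAB hyA)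
  exact mem_iUnion.2 ⟨i, mem_iInter.1 hyO i, hi⟩

theorem Accumulates.inter_of_mem_nhds {X : Type*} [TopologicalSpace X] {x : X} {A U : Set X}
    (hA : Accumulates A x) (hU : U ∈ 𝓝 x) : Accumulates (A ∩ U) x := fun O hO ↦ by
  rw [inter_comm A, ← inter_assoc]
  exact hA (O ∩ U) (inter_mem hO hU)

/-- A continuous map whose fibers on `A` are finite preserves accumulation of `A`. -/
theorem Accumulates.image {X Y : Type*} [TopologicalSpace X] [TopologicalSpace Y] {x : X}
    {A : Set X} {f : X → Y} (hA : Accumulates A x) (hf : ContinuousAt f x)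
    (hfib : ∀ a ∈ A, (A ∩ f ⁻¹' {f a}).Finite) : Accumulates (f '' A) (f x) := by
  intro O hO hfin
  refine hA (f ⁻¹' O) (hf hO) ?_
  refine (hfin.biUnion (t := fun y ↦ A ∩ f ⁻¹' {y}) ?_).subset ?_
  · rintro y ⟨-, a, ha, rfl⟩
    exact hfib a ha
  · rintro a ⟨haO, haA⟩
    exact mem_biUnion (⟨haO, a, haA, rfl⟩ : f a ∈ O ∩ f '' A) ⟨haA, rfl⟩

/-- A set containing every point common to all neighborhoods of `x`, whose complement does not
accumulate at `x`, is a neighborhood of `x`. -/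
theorem mem_nhds_of_not_accumulates_compl {X : Type*} [TopologicalSpace X] {x : X} {P : Set X}
    (hker : (𝓝 x).ker ⊆ P) (hP : ¬ Accumulates Pᶜ x) : P ∈ 𝓝 x := by
  simp only [Accumulates, not_forall, not_infinite] at hP
  obtain ⟨W, hW, hfin⟩ := hP
  have hsep : ∀ z ∈ W ∩ Pᶜ, {z}ᶜ ∈ 𝓝 x := fun z hz ↦ by
    have hz' : z ∉ (𝓝 x).ker := fun h ↦ hz.2 (hker h)
    simp only [Filter.mem_ker, not_forall] at hz'
    obtain ⟨V, hV, hzV⟩ := hz'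
    exact mem_of_superset hV (subset_compl_singleton_iff.2 hzV)
  filter_upwards [hW, (biInter_mem hfin).2 hsep] with y hyW hy
  by_contra hyP
  exact mem_iInter₂.1 hy y ⟨hyW, hyP⟩ rfl

/-- Under the strong Pytkeev property, every neighborhood of `x` contains an increasing sequence
of members of a fixed countable family which covers a neighborhood of `x` and captures infinitely
many points of each set accumulating at `x`. -/
theorem StrongPytkeevAt.exists_monotone {X : Type*} [TopologicalSpace X] {x : X}
    (h : StrongPytkeevAt X x) :
    ∃ 𝒩 : Set (Set X), 𝒩.Countable ∧ ∀ U ∈ 𝓝 x, ∃ P : ℕ → Set X, Monotone P ∧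
      (∀ k, P k ∈ 𝒩) ∧ (∀ k, P k ⊆ U) ∧ (⋃ k, P k) ∈ 𝓝 x ∧
      ∀ A, Accumulates A x → ∃ k, (P k ∩ A).Infinite := by
  obtain ⟨𝒩, hc, hN⟩ := h
  refine ⟨(fun F ↦ ⋃₀ F ∪ (𝓝 x).ker) '' {F | F.Finite ∧ F ⊆ insert ∅ 𝒩},
    (countable_ofPred_finite_subset (hc.insert ∅)).image _, fun U hU ↦ ?_⟩
  obtain ⟨e, he⟩ := ((hc.mono (sep_subset 𝒩 (· ⊆ U))).insert ∅).exists_eq_range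
    (insert_nonempty _ _)
  have heU : ∀ n, e n ∈ insert ∅ {N ∈ 𝒩 | N ⊆ U} := fun n ↦ he ▸ mem_range_self n
  have hmem : ∀ N ∈ 𝒩, N ⊆ U → ∃ k, e k = N := fun N h1 h2 ↦ by
    have : N ∈ range e := he ▸ mem_insert_of_mem _ ⟨h1, h2⟩
    exact this
  let P : ℕ → Set X := fun k ↦ ⋃₀ (e '' Iic k) ∪ (𝓝 x).ker
  have heP : ∀ k, e k ⊆ P k := fun k ↦
    (subset_sUnion_of_mem (mem_image_of_mem e self_mem_Iic)).trans subset_union_left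
  have hacc : ∀ A, Accumulates A x → ∃ k, (P k ∩ A).Infinite := fun A hA ↦ by
    obtain ⟨N, hN𝒩, hNU, hinf⟩ := hN U hU A hA
    obtain ⟨k, rfl⟩ := hmem N hN𝒩 hNU
    exact ⟨k, hinf.mono (inter_subset_inter_left _ (heP k))⟩
  refine ⟨P, fun i j hij ↦ ?_, fun k ↦ ?_, fun k ↦ ?_, ?_, hacc⟩
  · exact union_subset_union_left _ (sUnion_subset_sUnion (image_mono (Iic_subset_Iic.2 hij)))
  · refine ⟨_, ⟨(finite_Iic k).image e, ?_⟩, rfl⟩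
    rintro _ ⟨n, -, rfl⟩
    exact insert_subset_insert (sep_subset _ _) (heU n)
  · refine union_subset (sUnion_subset ?_) fun z hz ↦ Filter.mem_ker.1 hz U hU
    rintro _ ⟨n, -, rfl⟩
    rcases heU n with h0 | h1
    · simp [h0]
    · exact h1.2
  · refine mem_nhds_of_not_accumulates_compl
      (subset_iUnion_of_subset 0 subset_union_right) fun hcompl ↦ ?_
    obtain ⟨k, hk⟩ := hacc _ hcompl
    obtain ⟨y, hyk, hy⟩ := hk.nonempty
    exact hy (mem_iUnion_of_mem k hyk)

/-- If every `P i` is an increasing sequence covering a neighborhood of `p i` and capturing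
infinitely many points of each set accumulating at `p i`, then the boxes over a finite set of
coordinates capture infinitely many points of each set accumulating at `p`. -/
theorem Accumulates.exists_infinite_inter_pi {ι : Type*} {X : ι → Type*}
    [∀ i, TopologicalSpace (X i)] {p : ∀ i, X i} {A : Set (∀ i, X i)} (hA : Accumulates A p)
    (I : Finset ι) {P : ∀ i, ℕ → Set (X i)} (hmono : ∀ i, Monotone (P i))
    (hnhds : ∀ i, (⋃ k, P i k) ∈ 𝓝 (p i))
    (hacc : ∀ i, ∀ B, Accumulates B (p i) → ∃ k, (P i k ∩ B).Infinite) :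
    ∃ k, ((I : Set ι).pi (fun i ↦ P i k) ∩ A).Infinite := by
  rcases I.eq_empty_or_nonempty with rfl | hI
  · exact ⟨0, by simpa using hA univ univ_mem⟩
  by_contra! hfin
  have hbox : (I : Set ι).pi (fun i ↦ ⋃ k, P i k) ∈ 𝓝 p :=
    set_pi_mem_nhds I.finite_toSet fun i _ ↦ hnhds i
  -- The points whose `i`-th coordinate is the last one in `I` to be reached.
  let B : I → Set (∀ i, X i) := fun i ↦
    {a ∈ A | (∃ k, a i ∈ P i k) ∧ ∀ k, a i ∈ P i k → ∀ j ∈ I, a j ∈ P j k}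
  have hcover : A ∩ (I : Set ι).pi (fun i ↦ ⋃ k, P i k) ⊆ ⋃ i, B i := by
    classical
    rintro a ⟨haA, ha⟩
    have ha' : ∀ i ∈ I, ∃ k, a i ∈ P i k := fun i hi ↦ mem_iUnion.1 (ha i hi)
    let level : I → ℕ := fun i ↦ Nat.find (ha' i i.2)
    have : Nonempty I := hI.to_subtype
    obtain ⟨i, hi⟩ := Finite.exists_max level
    refine mem_iUnion.2 ⟨i, haA, ha' i i.2, fun k hk j hj ↦ ?_⟩
    exact hmono j ((hi ⟨j, hj⟩).trans (Nat.find_min' _ hk)) (Nat.find_spec (ha' j hj))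
  obtain ⟨i, hi⟩ := (hA.inter_of_mem_nhds hbox).exists_of_subset_iUnion hcover
  have hBfin : ∀ k, {a ∈ B i | a i ∈ P i k}.Finite := fun k ↦
    (hfin k).subset fun a ha ↦ ⟨fun j hj ↦ ha.1.2.2 k ha.2 j hj, ha.1.1⟩
  have himage : Accumulates (Function.eval (i : ι) '' B i) (p i) := by
    refine hi.image (continuous_apply (i : ι)).continuousAt fun a ha ↦ ?_
    obtain ⟨k, hk⟩ := ha.2.1
    refine (hBfin k).subset fun b hb ↦ ⟨hb.1, ?_⟩
    have hba : b i = a i := hb.2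
    rwa [hba]
  obtain ⟨k, hk⟩ := hacc i _ himage
  refine hk (((hBfin k).image (Function.eval (i : ι))).subset ?_)
  rintro _ ⟨hyP, a, ha, rfl⟩
  exact ⟨a, ⟨ha, hyP⟩, rfl⟩

/-- If each pointed space `(X n, p n)` has the strong Pytkeev property at its
distinguished point, then the Tychonoff product `∏ n, X n` has the strong Pytkeev
property at the point `p = (p n)ₙ`. -/
theorem strongPytkeevAt_pi (X : ℕ → Type*) [∀ n, TopologicalSpace (X n)]
    (p : ∀ n, X n) (h : ∀ n, StrongPytkeevAt (X n) (p n)) :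
    StrongPytkeevAt (∀ n, X n) p := by
  choose 𝒩 hc hN using fun n ↦ (h n).exists_monotone
  refine ⟨⋃ I : Finset ℕ, (fun f : ∀ i : I, Set (X i) ↦ {x | ∀ i : I, x i ∈ f i}) ''
    {f | ∀ i : I, f i ∈ 𝒩 i},
    countable_iUnion fun I ↦ (countable_pi fun i : I ↦ hc i).image _, fun O hO A hA ↦ ?_⟩
  rw [nhds_pi, Filter.mem_pi] at hO
  obtain ⟨I, hI, U, hU, hUO⟩ := hO
  lift I to Finset ℕ using hI
  choose P hmono hP𝒩 hPU hnhds hacc using fun n ↦ hN n (U n) (hU n)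
  obtain ⟨k, hk⟩ := hA.exists_infinite_inter_pi I hmono hnhds hacc
  refine ⟨_, mem_iUnion.2 ⟨I, fun i ↦ P i k, fun i ↦ hP𝒩 i k, rfl⟩, ?_, hk.mono ?_⟩
  · exact fun x hx ↦ hUO fun i hi ↦ hPU i k (hx ⟨i, hi⟩)
  · exact inter_subset_inter_left _ fun x hx i ↦ hx i i.2
end

section
/- Let (X_n)_{n∈ℕ} be T₁ topological spaces and let *_n ∈ X_n be points such that each X_n has the strong Pytkeev property at *_n. Endow the Cartesian product ∏_{n∈ℕ} X_n with the box topology (generated by the sets ∏_{n∈ℕ} U_n with each U_n open in X_n), and let the small box-product ⊡_{n∈ℕ} X_n be the subspace consisting of all points (x_n)_{n∈ℕ} such that x_n = *_n for all but finitely many n. Then ⊡_{n∈ℕ} X_n has the strong Pytkeev property at the point (*_n)_{n∈ℕ}. -/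
open Set Filter Topology

/-- The box topology on the product `∀ n, X n`, generated by boxes `∏ n, U n`
of open sets. -/
def boxTopology (X : ℕ → Type*) [∀ n, TopologicalSpace (X n)] :
    TopologicalSpace (∀ n, X n) :=
  TopologicalSpace.generateFrom
    {S | ∃ U : ∀ n, Set (X n), (∀ n, IsOpen (U n)) ∧ S = {x | ∀ n, x n ∈ U n}}

theorem isTopologicalBasis_boxTopology (X : ℕ → Type*) [∀ n, TopologicalSpace (X n)] :
    @TopologicalSpace.IsTopologicalBasis (∀ n, X n) (boxTopology X)
      {S | ∃ U : ∀ n, Set (X n), (∀ n, IsOpen (U n)) ∧ S = {x | ∀ n, x n ∈ U n}} := by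
  let := boxTopology X
  refine ⟨?_, ?_, rfl⟩
  · rintro _ ⟨U, hU, rfl⟩ _ ⟨V, hV, rfl⟩ x hx
    exact ⟨{y | ∀ n, y n ∈ U n ∩ V n}, ⟨fun n => U n ∩ V n, fun n => (hU n).inter (hV n), rfl⟩,
      fun n => ⟨hx.1 n, hx.2 n⟩, fun y hy => ⟨fun n => (hy n).1, fun n => (hy n).2⟩⟩
  · exact eq_univ_of_forall fun x =>
      ⟨univ, ⟨fun _ => univ, fun _ => isOpen_univ, by simp⟩, mem_univ x⟩

theorem mem_nhds_induced_boxTopology {X : ℕ → Type*} [∀ n, TopologicalSpace (X n)]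
    {Y : Type*} (f : Y → ∀ n, X n) {y : Y} {O : Set Y} :
    O ∈ @nhds Y (TopologicalSpace.induced f (boxTopology X)) y ↔
      ∃ V : ∀ n, Set (X n), (∀ n, V n ∈ 𝓝 (f y n)) ∧ {z | ∀ n, f z n ∈ V n} ⊆ O := by
  let := boxTopology X
  rw [@mem_nhds_induced _ _ (boxTopology X)]
  constructor
  · rintro ⟨u, hu, huO⟩
    obtain ⟨_, ⟨V, hV, rfl⟩, hy, hVu⟩ :=
      (isTopologicalBasis_boxTopology X).mem_nhds_iff.1 hu
    exact ⟨V, fun n => (hV n).mem_nhds (hy n), fun z hz => huO (hVu hz)⟩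
  · rintro ⟨V, hV, hVO⟩
    refine ⟨{x | ∀ n, x n ∈ V n}, (isTopologicalBasis_boxTopology X).mem_nhds_iff.2
      ⟨_, ⟨fun n => interior (V n), fun n => isOpen_interior, rfl⟩,
        fun n => mem_interior_iff_mem_nhds.2 (hV n), fun x hx n => interior_subset (hx n)⟩, hVO⟩

theorem compl_mem_nhds_of_not_accumulates {X : Type*} [TopologicalSpace X] [T1Space X]
    {C : Set X} {x : X} (hC : ¬ Accumulates C x) (hx : x ∉ C) : Cᶜ ∈ 𝓝 x := by
  simp only [Accumulates, not_forall, not_infinite] at hC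
  obtain ⟨O, hO, hfin⟩ := hC
  have : (O ∩ C)ᶜ ∈ 𝓝 x := hfin.isClosed.isOpen_compl.mem_nhds fun h => hx h.2
  filter_upwards [hO, this] with y hyO hy hyC using hy ⟨hyO, hyC⟩

theorem StrongPytkeevAt.exists_seq {X : Type*} [TopologicalSpace X] {x : X}
    (h : StrongPytkeevAt X x) : ∃ e : ℕ → Set X, IsPytkeevNetworkAt (range e) x := by
  obtain ⟨𝒩, hc, hN⟩ := h
  obtain ⟨e, he⟩ := countable_iff_exists_subset_range.1 hc
  refine ⟨e, fun O hO A hA => ?_⟩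
  obtain ⟨N, hN, h⟩ := hN O hO A hA
  exact ⟨N, he hN, h⟩

/-- If `L n k` are increasing in `k`, start at `{p n}` and every set accumulating at `p n` has
infinite trace on some `L n k`, then a set of points of finite support with finite trace on every
`∏ n, L n k` is avoided, except for `p`, by a box of neighborhoods. -/
theorem exists_box_inter_subset_singleton {X : ℕ → Type*} [∀ n, TopologicalSpace (X n)]
    [∀ n, T1Space (X n)] {p : ∀ n, X n} {L : ∀ n, ℕ → Set (X n)} (hmono : ∀ n, Monotone (L n))
    (hzero : ∀ n, L n 0 = {p n})
    (hacc : ∀ n (C : Set (X n)), Accumulates C (p n) → ∃ k, (L n k ∩ C).Infinite)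
    {A : Set (∀ n, X n)} (hsupp : ∀ x ∈ A, {n | x n ≠ p n}.Finite)
    (hfin : ∀ k, ({x | ∀ n, x n ∈ L n k} ∩ A).Finite) :
    ∃ W : ∀ n, Set (X n), (∀ n, W n ∈ 𝓝 (p n)) ∧ {x | ∀ n, x n ∈ W n} ∩ A ⊆ {p} := by
  have hp : ∀ n k, p n ∈ L n k := fun n k => hmono n k.zero_le (by simp [hzero])
  let C : ∀ n, Set (X n) := fun n => {y | y ≠ p n ∧ ((∀ k, y ∉ L n k) ∨
    ∃ a ∈ A, a n = y ∧ ∀ k, y ∈ L n k → ∀ m, a m ∈ L m k)}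
  refine ⟨fun n => (C n)ᶜ, fun n => compl_mem_nhds_of_not_accumulates (fun hC => ?_)
    fun h => h.1 rfl, ?_⟩
  · obtain ⟨k, hk⟩ := hacc n _ hC
    refine hk (((hfin k).image fun a => a n).subset ?_)
    rintro y ⟨hyL, -, hy | ⟨a, ha, rfl, haL⟩⟩
    · exact absurd hyL (hy k)
    · exact ⟨a, ⟨haL k hyL, ha⟩, rfl⟩
  · rintro x ⟨hxW, hxA⟩
    by_contra hxp
    have hx : ∀ n, ∃ k, x n ∈ L n k := fun n => by
      by_contra! hn
      exact hxW n ⟨fun h => hn 0 (h ▸ hp n 0), .inl hn⟩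
    choose k hk using hx
    have hex : ∃ K, ∀ n, x n ∈ L n K := by
      refine ⟨(hsupp x hxA).toFinset.sup k, fun n => ?_⟩
      by_cases hn : x n = p n
      · exact hn ▸ hp n _
      · exact hmono n (Finset.le_sup ((hsupp x hxA).mem_toFinset.2 hn)) (hk n)
    classical
    have hK := Nat.find_spec hex
    have hlt : ∀ m < Nat.find hex, ¬ ∀ n, x n ∈ L n m := fun m => Nat.find_min hex
    generalize Nat.find hex = K at hK hlt
    cases K with
    | zero => exact hxp (funext fun n => by simpa [hzero] using hK n)
    | succ m =>
      obtain ⟨n, hn⟩ := not_forall.1 (hlt m m.lt_succ_self)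
      refine hxW n ⟨fun h => hn (h ▸ hp n m), .inr ⟨x, hxA, rfl, fun j hj i => ?_⟩⟩
      have hmj : m < j := lt_of_not_ge fun hjm => hn (hmono n hjm hj)
      exact hmono i hmj (hK i)

/-- If `(X n)` are T₁ pointed spaces with the strong Pytkeev property at their
distinguished points `p n`, then the small box-product `⊡ₙ X n` (the subspace of the
box product consisting of points equal to `p n` for all but finitely many `n`) has the
strong Pytkeev property at the distinguished point `(p n)ₙ`. -/
theorem strongPytkeevAt_smallBoxProduct (X : ℕ → Type*) [∀ n, TopologicalSpace (X n)]
    [∀ n, T1Space (X n)] (p : ∀ n, X n) (h : ∀ n, StrongPytkeevAt (X n) (p n)) :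
    @StrongPytkeevAt {x : ∀ n, X n // {n : ℕ | x n ≠ p n}.Finite}
      (TopologicalSpace.induced Subtype.val (boxTopology X))
      ⟨p, by simp⟩ := by
  choose e he using fun n => (h n).exists_seq
  let B : Finset (ℕ × ℕ) → Set {x : ∀ n, X n // {n : ℕ | x n ≠ p n}.Finite} := fun F =>
    {x | ∀ n, x.1 n = p n ∨ ∃ j, (n, j) ∈ F ∧ x.1 n ∈ e n j}
  refine ⟨range B, countable_range B, fun O hO A hA => ?_⟩
  by_contra! hcon
  obtain ⟨V, hV, hVO⟩ := (mem_nhds_induced_boxTopology _).1 hO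
  let L : ∀ n, ℕ → Set (X n) := fun n k =>
    {y | y = p n ∨ ∃ j, (n < k ∧ j < k ∧ e n j ⊆ V n) ∧ y ∈ e n j}
  suffices ∃ W : ∀ n, Set (X n), (∀ n, W n ∈ 𝓝 (p n)) ∧
      {x | ∀ n, x n ∈ W n} ∩ Subtype.val '' A ⊆ {p} by
    obtain ⟨W, hW, hWA⟩ := this
    refine hA {z | ∀ n, z.1 n ∈ W n}
      ((mem_nhds_induced_boxTopology _).2 ⟨W, hW, Subset.rfl⟩) ?_
    refine Set.Subsingleton.finite fun x hx y hy => Subtype.ext ?_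
    exact (hWA ⟨hx.1, x, hx.2, rfl⟩).trans (hWA ⟨hy.1, y, hy.2, rfl⟩).symm
  refine exists_box_inter_subset_singleton (L := L) ?_ ?_ ?_ ?_ ?_
  · rintro n k l hkl y (hy | ⟨j, ⟨hn, hj, hjV⟩, hy⟩)
    · exact .inl hy
    · exact .inr ⟨j, ⟨hn.trans_le hkl, hj.trans_le hkl, hjV⟩, hy⟩
  · intro n
    ext y
    simp [L]
  · intro n C hC
    obtain ⟨_, ⟨j, rfl⟩, hjV, hinf⟩ := he n _ (hV n) C hC
    exact ⟨max n j + 1, hinf.mono (inter_subset_inter_left _ fun y hy =>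
      .inr ⟨j, ⟨by omega, by omega, hjV⟩, hy⟩)⟩
  · rintro _ ⟨x, -, rfl⟩
    exact x.2
  · intro k
    classical
    let F : Finset (ℕ × ℕ) :=
      (Finset.range k ×ˢ Finset.range k).filter fun q => e q.1 q.2 ⊆ V q.1
    have hF : ∀ n j, (n, j) ∈ F ↔ n < k ∧ j < k ∧ e n j ⊆ V n := by
      simp [F, and_assoc]
    have hBO : B F ⊆ O := fun x hx => hVO fun n => by
      rcases hx n with hn | ⟨j, hj, hn⟩
      · exact hn ▸ mem_of_mem_nhds (hV n)
      · exact ((hF n j).1 hj).2.2 hn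
    refine ((hcon _ ⟨F, rfl⟩ hBO).image Subtype.val).subset ?_
    rintro _ ⟨hx, x, hxA, rfl⟩
    refine ⟨x, ⟨fun n => ?_, hxA⟩, rfl⟩
    exact (hx n).imp_right fun ⟨j, hj, hy⟩ => ⟨j, (hF n j).2 hj, hy⟩
end

section
/- Let X be a Hausdorff topological space and let Y be a topological lop with operation (y,y') ↦ y·y' and unit e. Then C_k(X,Y), equipped with the pointwise operation (f·g)(x) = f(x)·g(x), is a topological lop: the pointwise operation C_k(X,Y) × C_k(X,Y) → C_k(X,Y) is continuous, the constant function with value e is a two-sided unit, and the map (f,g) ↦ (f, f·g) is a homeomorphism of C_k(X,Y) × C_k(X,Y) onto itself. -/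
open Set Filter Topology

/-- Pairing of continuous maps on an `R1` space is jointly continuous in the compact-open
topology. -/
theorem ContinuousMap.continuous_prodMk_of_r1Space {X Y Z : Type*} [TopologicalSpace X] [R1Space X]
    [TopologicalSpace Y] [TopologicalSpace Z] :
    Continuous fun q : C(X, Y) × C(X, Z) => q.1.prodMk q.2 := by
  refine continuous_iff_continuousAt.2 fun ⟨f, g⟩ =>
    ContinuousMap.tendsto_nhds_compactOpen.2 fun K hK U hU hKU => ?_
  refine hK.induction_on
    (p := fun s => ∀ᶠ q : C(X, Y) × C(X, Z) in 𝓝 (f, g), MapsTo (q.1.prodMk q.2) s U)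
    (Eventually.of_forall fun _ => mapsTo_empty _ _)
    (fun s t hst ht => ht.mono fun _ h => h.mono_left hst)
    (fun s t hs ht => hs.mp (ht.mono fun _ h₁ h₂ => h₂.union h₁)) fun x hx => ?_
  obtain ⟨V, W, hV, hfV, hW, hgW, hVW⟩ := mem_nhds_prod_iff'.1 (hU.mem_nhds (hKU hx))
  have hn : f ⁻¹' V ∩ g ⁻¹' W ∈ 𝓝 x :=
    inter_mem (f.continuous.continuousAt.preimage_mem_nhds (hV.mem_nhds hfV))
      (g.continuous.continuousAt.preimage_mem_nhds (hW.mem_nhds hgW))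
  have : CompactSpace K := isCompact_iff_compactSpace.1 hK
  obtain ⟨L, hL, hLsub, hLc⟩ := local_compact_nhds
    (continuous_subtype_val.continuousAt.preimage_mem_nhds (x := (⟨x, hx⟩ : K)) hn)
  have hLX : IsCompact (Subtype.val '' L) := hLc.image continuous_subtype_val
  refine ⟨Subtype.val '' L, ?_, ?_⟩
  · rw [nhdsWithin_eq_map_subtype_coe hx]
    exact image_mem_map hL
  · have h₁ := ContinuousMap.eventually_mapsTo (f := f) hLX hV
      (by rintro _ ⟨y, hy, rfl⟩; exact (hLsub hy).1)
    have h₂ := ContinuousMap.eventually_mapsTo (f := g) hLX hW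
      (by rintro _ ⟨y, hy, rfl⟩; exact (hLsub hy).2)
    filter_upwards [h₁.prod_nhds h₂] with q hq y hy
    exact hVW ⟨hq.1 hy, hq.2 hy⟩

/-- A homeomorphism of products of spaces induces one of products of mapping spaces. -/
def Homeomorph.continuousMapProdCongr (X : Type*) {A B C D : Type*} [TopologicalSpace X]
    [R1Space X] [TopologicalSpace A] [TopologicalSpace B] [TopologicalSpace C]
    [TopologicalSpace D] (H : A × B ≃ₜ C × D) :
    C(X, A) × C(X, B) ≃ₜ C(X, C) × C(X, D) where
  toFun q := (ContinuousMap.fst.comp ((H : C(A × B, C × D)).comp (q.1.prodMk q.2)),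
    ContinuousMap.snd.comp ((H : C(A × B, C × D)).comp (q.1.prodMk q.2)))
  invFun q := (ContinuousMap.fst.comp ((H.symm : C(C × D, A × B)).comp (q.1.prodMk q.2)),
    ContinuousMap.snd.comp ((H.symm : C(C × D, A × B)).comp (q.1.prodMk q.2)))
  left_inv q := by ext x <;> simp
  right_inv q := by ext x <;> simp
  continuous_toFun := by
    have h := (ContinuousMap.continuous_postcomp (H : C(A × B, C × D))).comp
      (ContinuousMap.continuous_prodMk_of_r1Space (X := X))
    exact ((ContinuousMap.continuous_postcomp _).comp h).prodMk
      ((ContinuousMap.continuous_postcomp _).comp h)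
  continuous_invFun := by
    have h := (ContinuousMap.continuous_postcomp (H.symm : C(C × D, A × B))).comp
      (ContinuousMap.continuous_prodMk_of_r1Space (X := X))
    exact ((ContinuousMap.continuous_postcomp _).comp h).prodMk
      ((ContinuousMap.continuous_postcomp _).comp h)

/-- For a Hausdorff space `X` and a topological lop `Y` (a space with a continuous binary
operation `m` having a two-sided unit `e` such that `(y,y') ↦ (y, y·y')` is a
homeomorphism), the function space `C_k(X,Y)` with the pointwise operation is a
topological lop: the pointwise operation is continuous, the constant function `e` is a
two-sided unit, and `(f,g) ↦ (f, f·g)` is a homeomorphism of `C_k(X,Y) × C_k(X,Y)`. -/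
theorem compactOpen_topological_lop {X Y : Type*} [TopologicalSpace X] [T2Space X]
    [TopologicalSpace Y]
    (m : Y → Y → Y) (hm : Continuous fun q : Y × Y => m q.1 q.2)
    (e : Y) (he : ∀ y : Y, m e y = y ∧ m y e = y)
    (H : Y × Y ≃ₜ Y × Y) (hH : ∀ q : Y × Y, H q = (q.1, m q.1 q.2)) :
    ∃ M : C(X, Y) → C(X, Y) → C(X, Y),
      (∀ (f g : C(X, Y)) (x : X), M f g x = m (f x) (g x)) ∧
      Continuous (fun q : C(X, Y) × C(X, Y) => M q.1 q.2) ∧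
      (∀ f : C(X, Y), M (ContinuousMap.const X e) f = f ∧ M f (ContinuousMap.const X e) = f) ∧
      ∃ HC : C(X, Y) × C(X, Y) ≃ₜ C(X, Y) × C(X, Y),
        ∀ q : C(X, Y) × C(X, Y), HC q = (q.1, M q.1 q.2) := by
  refine ⟨fun f g => (ContinuousMap.mk _ hm).comp (f.prodMk g), fun _ _ _ => rfl,
    (ContinuousMap.continuous_postcomp _).comp ContinuousMap.continuous_prodMk_of_r1Space,
    fun f => ⟨ContinuousMap.ext fun x => (he (f x)).1, ContinuousMap.ext fun x => (he (f x)).2⟩,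
    H.continuousMapProdCongr X, fun q => ?_⟩
  ext x
  · exact congrArg Prod.fst (hH (q.1 x, q.2 x))
  · exact congrArg Prod.snd (hH (q.1 x, q.2 x))
end

section
/- Let X be a Hausdorff topological space and let Y be a rectifiable topological space. Then the function space C_k(X,Y) is rectifiable. -/
open Set Filter Topology

/-- A topological space `Y` is rectifiable if there is a point `e ∈ Y` and a
homeomorphism `H : Y × Y ≃ₜ Y × Y` such that `H (y, e) = (y, y)` for all `y` and
`H` preserves the first coordinate. -/
def Rectifiable (Y : Type*) [TopologicalSpace Y] : Prop :=
  ∃ e : Y, ∃ H : Y × Y ≃ₜ Y × Y,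
    (∀ y : Y, H (y, e) = (y, y)) ∧ ∀ q : Y × Y, (H q).1 = q.1

/-- A compact subset of a Hausdorff space is locally compact in itself. -/
theorem IsCompact.exists_isCompact_mem_nhdsWithin {X : Type*} [TopologicalSpace X] [T2Space X]
    {K : Set X} (hK : IsCompact K) {x : X} (hx : x ∈ K) {U : Set X} (hU : U ∈ 𝓝 x) :
    ∃ L ∈ 𝓝[K] x, IsCompact L ∧ L ⊆ U := by
  have : CompactSpace K := isCompact_iff_compactSpace.mp hK
  obtain ⟨L, hL, hLU, hLc⟩ := local_compact_nhds
    (continuous_subtype_val.continuousAt.preimage_mem_nhds hU : Subtype.val ⁻¹' U ∈ 𝓝 (⟨x, hx⟩ : K))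
  refine ⟨Subtype.val '' L, ?_, hLc.image continuous_subtype_val, image_subset_iff.mpr hLU⟩
  rw [nhdsWithin_eq_map_subtype_coe hx]
  exact image_mem_map hL

/-- On a Hausdorff domain, pairing of maps is continuous in the compact-open topologies. -/
theorem ContinuousMap.continuous_prodMk_compactOpen {X Y Z : Type*} [TopologicalSpace X]
    [T2Space X] [TopologicalSpace Y] [TopologicalSpace Z] :
    Continuous fun p : C(X, Y) × C(X, Z) ↦ p.1.prodMk p.2 := by
  rw [continuous_iff_continuousAt]
  rintro ⟨f, g⟩
  refine ContinuousMap.tendsto_nhds_compactOpen.mpr fun K hK U hU hKU ↦ ?_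
  refine hK.induction_on
    (p := fun S ↦ ∀ᶠ p : C(X, Y) × C(X, Z) in 𝓝 (f, g), MapsTo (p.1.prodMk p.2) S U)
    (Eventually.of_forall fun _ ↦ mapsTo_empty _ _)
    (fun S T hST hT ↦ hT.mono fun _ h ↦ h.mono_left hST)
    (fun S T hS hT ↦ hS.mp <| hT.mono fun _ hT hS ↦ hS.union hT) fun x hx ↦ ?_
  obtain ⟨V, W, hV, hfV, hW, hgW, hVW⟩ := mem_nhds_prod_iff'.mp (hU.mem_nhds (hKU hx))
  obtain ⟨L, hL, hLc, hLVW⟩ := hK.exists_isCompact_mem_nhdsWithin hx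
    (inter_mem (f.continuous.continuousAt.preimage_mem_nhds (hV.mem_nhds hfV))
      (g.continuous.continuousAt.preimage_mem_nhds (hW.mem_nhds hgW)))
  refine ⟨L, hL, ?_⟩
  rw [nhds_prod_eq]
  filter_upwards [(ContinuousMap.eventually_mapsTo hLc hV fun y hy ↦ (hLVW hy).1).prod_mk
    (ContinuousMap.eventually_mapsTo hLc hW fun y hy ↦ (hLVW hy).2)] with p hp y hy
  exact hVW ⟨hp.1 hy, hp.2 hy⟩

/-- On a Hausdorff domain, maps into a product are pairs of maps, homeomorphically. -/
def ContinuousMap.prodHomeomorph (X Y Z : Type*) [TopologicalSpace X] [T2Space X]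
    [TopologicalSpace Y] [TopologicalSpace Z] : C(X, Y) × C(X, Z) ≃ₜ C(X, Y × Z) where
  toFun p := p.1.prodMk p.2
  invFun f := (ContinuousMap.fst.comp f, ContinuousMap.snd.comp f)
  left_inv _ := rfl
  right_inv _ := rfl
  continuous_toFun := ContinuousMap.continuous_prodMk_compactOpen
  continuous_invFun := (ContinuousMap.continuous_postcomp _).prodMk
    (ContinuousMap.continuous_postcomp _)

/-- For a Hausdorff space `X` and a rectifiable space `Y`, the function space
`C_k(X,Y)` (continuous maps with the compact-open topology) is rectifiable. -/
theorem rectifiable_compactOpen {X Y : Type*} [TopologicalSpace X] [T2Space X]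
    [TopologicalSpace Y] (hY : Rectifiable Y) :
    Rectifiable C(X, Y) := by
  obtain ⟨e, H, hH, hfst⟩ := hY
  let P := ContinuousMap.prodHomeomorph X Y Y
  refine ⟨ContinuousMap.const X e,
    (P.trans ((Homeomorph.refl X).arrowCongr H)).trans P.symm, fun f ↦ ?_, fun q ↦ ?_⟩
  · refine Prod.ext (ContinuousMap.ext fun x ↦ ?_) (ContinuousMap.ext fun x ↦ ?_)
    · exact congrArg Prod.fst (hH (f x))
    · exact congrArg Prod.snd (hH (f x))
  · exact ContinuousMap.ext fun x ↦ hfst (q.1 x, q.2 x)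
end

section
/- Let X be a regular countably compact topological space (every infinite subset of X has an accumulation point in X) such that the square X×X has countable fan open-tightness at every point of the diagonal Δ_X = {(x,x) : x ∈ X}. Let Y be a T₁ topological space, e ∈ Y, and let q : X×X → Y be a continuous map with q⁻¹({e}) = Δ_X. If Y has the strong Pytkeev property at e, then X is metrizable. -/
open Set Filter Topology

/-- `X` has countable fan open-tightness at `x`. -/
def FanOpenTightnessAt (X : Type*) [TopologicalSpace X] (x : X) : Prop :=
  ∀ A : ℕ → Set X, (∀ n, IsOpen (A n)) → (∀ n, x ∈ closure (A n)) →
    ∃ F : ℕ → Set X, (∀ n, F n ⊆ A n) ∧ (∀ n, (F n).Finite) ∧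
      ∀ O ∈ 𝓝 x, {n : ℕ | (O ∩ F n).Nonempty}.Infinite

/-- If every infinite subset of a `T₁` space accumulates at some point, then the space is countably
compact. -/
theorem CountablyCompactSpace.of_forall_exists_accumulates {X : Type*} [TopologicalSpace X]
    [T1Space X] (h : ∀ A : Set X, A.Infinite → ∃ x : X, Accumulates A x) :
    CountablyCompactSpace X := by
  refine ⟨isCountablyCompact_iff_infinite_subset_has_accPt.2 fun B _ hB => ?_⟩
  obtain ⟨x, hx⟩ := h B hB
  refine ⟨x, mem_univ x, accPt_iff_nhds.2 fun U hU => ?_⟩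
  obtain ⟨y, hy, hyx⟩ := (hx U hU).exists_notMem_finite (finite_singleton x)
  exact ⟨y, hy, hyx⟩

theorem CountablyCompactSpace.exists_mapClusterPt {X : Type*} [TopologicalSpace X]
    [CountablyCompactSpace X] (u : ℕ → X) : ∃ x, MapClusterPt x atTop u := by
  obtain ⟨x, -, hx⟩ := CountablyCompactSpace.isCountablyCompact_univ.seq_clusterPt u
    (Eventually.of_forall fun _ => mem_univ _)
  exact ⟨x, hx⟩

/-- A countable family of closed sets with the finite intersection property in a countably compact
space has a common point. -/
theorem CountablyCompactSpace.sInter_nonempty {X : Type*} [TopologicalSpace X]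
    [CountablyCompactSpace X] {S : Set (Set X)} (hS : S.Countable) (hcl : ∀ F ∈ S, IsClosed F)
    (hfin : ∀ u ⊆ S, u.Finite → (⋂₀ u).Nonempty) : (⋂₀ S).Nonempty := by
  by_contra hne
  obtain ⟨t, htS, ht, hcov⟩ :=
    (CountablyCompactSpace.isCountablyCompact_univ (E := X)).elim_finite_subcover_image hS
      (fun F hF => (hcl F hF).isOpen_compl) fun x _ => by
        by_contra hx
        exact hne ⟨x, by simpa using hx⟩
  obtain ⟨x, hx⟩ := hfin t htS ht
  obtain ⟨F, hF, hxF⟩ := mem_iUnion₂.1 (hcov (mem_univ x))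
  exact hxF (hx F hF)

/-- In a countably compact space, a family of closed sets with the finite intersection property
extends to a maximal one, which is closed under countable intersections. -/
theorem CountablyCompactSpace.exists_maximal_closed_family {X : Type*} [TopologicalSpace X]
    [CountablyCompactSpace X] {S : Set (Set X)} (hcl : ∀ F ∈ S, IsClosed F)
    (hfin : ∀ u ⊆ S, u.Finite → (⋂₀ u).Nonempty) :
    ∃ M : Set (Set X), S ⊆ M ∧ (∀ F ∈ M, F.Nonempty) ∧ (∀ F ∈ M, IsClosed F) ∧
      (∀ u ⊆ M, u.Countable → ⋂₀ u ∈ M) ∧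
      ∀ C, IsClosed C → C ∉ M → ∃ F ∈ M, Disjoint C F := by
  obtain ⟨M, hSM, hM⟩ := zorn_subset_nonempty
    {T : Set (Set X) | (∀ F ∈ T, IsClosed F) ∧ ∀ u ⊆ T, u.Finite → (⋂₀ u).Nonempty}
    (by
      intro c hc hchain hne
      refine ⟨⋃₀ c, ⟨?_, ?_⟩, fun s hs => subset_sUnion_of_mem hs⟩
      · rintro F ⟨T, hT, hF⟩
        exact (hc hT).1 F hF
      · intro u hu hufin
        obtain ⟨T, hT, huT⟩ :=
          DirectedOn.exists_mem_subset_of_finite_of_subset_sUnion hne hchain.directedOn hufin hu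
        exact (hc hT).2 u huT hufin)
    S ⟨hcl, hfin⟩
  obtain ⟨⟨hMcl, hMfin⟩, hmax⟩ := hM
  have hmem : ∀ C, IsClosed C → (∀ u ⊆ M, u.Finite → (C ∩ ⋂₀ u).Nonempty) → C ∈ M := by
    intro C hC hCu
    refine hmax (y := insert C M) ⟨?_, ?_⟩ (subset_insert C M) (mem_insert C M)
    · rintro F (rfl | hF)
      exacts [hC, hMcl F hF]
    · intro u hu hufin
      refine (hCu (u \ {C}) (by rwa [sdiff_singleton_subset_iff]) hufin.sdiff).mono ?_
      rintro x ⟨hxC, hx⟩ F hF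
      by_cases hFC : F = C
      · exact hFC ▸ hxC
      · exact hx F ⟨hF, hFC⟩
  have hinter : ∀ u ⊆ M, u.Countable → ⋂₀ u ∈ M := by
    intro u hu huc
    refine hmem _ (isClosed_sInter fun F hF => hMcl F (hu hF)) fun v hv hvfin => ?_
    rw [← sInter_union]
    exact CountablyCompactSpace.sInter_nonempty (huc.union hvfin.countable)
      (fun F hF => hMcl F (union_subset hu hv hF))
      fun w hw hwfin => hMfin w (hw.trans (union_subset hu hv)) hwfin
  refine ⟨M, hSM, fun F hF => ?_, hMcl, hinter, fun C hC hCM => ?_⟩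
  · simpa using hMfin {F} (singleton_subset_iff.2 hF) (finite_singleton F)
  · by_contra! hdisj
    refine hCM (hmem C hC fun u hu hufin => ?_)
    exact not_disjoint_iff_nonempty_inter.1 (hdisj _ (hinter u hu hufin.countable))

/-- Chaber's theorem: a countably compact space with a `Gδ` diagonal is compact. -/
theorem CompactSpace.of_countablyCompact_of_diagonal {X : Type*} [TopologicalSpace X]
    [CountablyCompactSpace X] {W : ℕ → Set (X × X)} (hWo : ∀ n, IsOpen (W n))
    (hW : ⋂ n, W n = diagonal X) : CompactSpace X := by
  have hdiag : ∀ n x, (x, x) ∈ W n := fun n x => by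
    have : (x, x) ∈ ⋂ n, W n := hW ▸ mem_diagonal x
    exact mem_iInter.1 this n
  refine compactSpace_of_finite_subfamily_closed fun {ι} t htcl ht => ?_
  by_contra! hfin
  obtain ⟨M, hSM, hne, hMcl, hinter, hdisj⟩ :=
    CountablyCompactSpace.exists_maximal_closed_family (S := range t)
      (by rintro _ ⟨i, rfl⟩; exact htcl i)
      (by
        intro u hu hufin
        obtain ⟨s, rfl⟩ := hufin.exists_finset_coe
        classical
        rw [← image_univ] at hu
        obtain ⟨v, -, rfl⟩ := Finset.subset_set_image_iff.1 hu
        simpa [sInter_image] using hfin v)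
  have hfree : ∀ x, ∃ F ∈ M, x ∉ F := fun x => by
    have : x ∉ ⋂ i, t i := by simp [ht]
    obtain ⟨i, hi⟩ := by simpa using this
    exact ⟨t i, hSM ⟨i, rfl⟩, hi⟩
  have hseq : ∀ G : ℕ → Set X, (∀ n, G n ∈ M) → ⋂ n, G n ∈ M := fun G hG => by
    simpa [sInter_range] using hinter (range G) (range_subset_iff.2 hG) (countable_range G)
  have hstar : ∀ x, ∃ n, ∃ F ∈ M, ∀ y ∈ F, (x, y) ∉ W n := by
    intro x
    obtain ⟨F, hF, hxF⟩ := hfree x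
    by_contra! hcon
    have hcl : ∀ n, IsClosed (F \ {y | (x, y) ∈ W n}) := fun n =>
      (hMcl F hF).sdiff ((hWo n).preimage (Continuous.prodMk_right x))
    have hnot : ∀ n, F \ {y | (x, y) ∈ W n} ∉ M := fun n hn => by
      obtain ⟨y, hy, hyW⟩ := hcon n _ hn
      exact hy.2 hyW
    choose G hGM hG using fun n => hdisj _ (hcl n) (hnot n)
    have hFG := hinter {F, ⋂ n, G n} (by
      rintro _ (rfl | rfl)
      exacts [hF, hseq G hGM]) (by simp)
    obtain ⟨y, hy⟩ := hne _ hFG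
    rw [sInter_pair] at hy
    have hyW : (x, y) ∈ ⋂ n, W n := mem_iInter.2 fun n => by
      by_contra hyn
      exact disjoint_left.1 (hG n) ⟨hy.1, hyn⟩ (mem_iInter.1 hy.2 n)
    obtain rfl : x = y := by rwa [hW] at hyW
    exact hxF hy.1
  obtain ⟨n, hn⟩ : ∃ n, ∀ F ∈ M, ∃ x ∈ F, ∃ F' ∈ M, ∀ y ∈ F', (x, y) ∉ W n := by
    by_contra! hcon
    choose G hGM hG using hcon
    obtain ⟨x, hx⟩ := hne _ (hseq G hGM)
    obtain ⟨n, F', hF', hxF'⟩ := hstar x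
    obtain ⟨y, hy, hyW⟩ := hG n x (mem_iInter.1 hx n) F' hF'
    exact hxF' y hy hyW
  have huniv : (univ : Set X) ∈ M := by
    simpa using hinter ∅ (empty_subset M) countable_empty
  have : Nonempty X := (hne _ huniv).to_type
  choose! f hfF g hgM hg using hn
  have hM2 : ∀ A ∈ M, ∀ B ∈ M, A ∩ B ∈ M := fun A hA B hB => by
    rw [← sInter_pair]
    exact hinter _ (by rintro _ (rfl | rfl) <;> assumption) (by simp)
  let K : ℕ → Set X := fun k => Nat.rec univ (fun _ A => A ∩ g A) k
  have hKM : ∀ k, K k ∈ M := by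
    intro k
    induction k with
    | zero => exact huniv
    | succ k ih => exact hM2 _ ih _ (hgM _ ih)
  have hKa : Antitone K := antitone_nat_of_succ_le fun k => inter_subset_left
  obtain ⟨x, hx⟩ := CountablyCompactSpace.exists_mapClusterPt fun k => f (K k)
  have hWx : W n ∈ 𝓝 (x, x) := (hWo n).mem_nhds (hdiag n x)
  rw [nhds_prod_eq, mem_prod_self_iff] at hWx
  obtain ⟨U, hU, hUW⟩ := hWx
  have hfreq := frequently_atTop.1 (mapClusterPt_iff_frequently.1 hx U hU)
  obtain ⟨i, -, hi⟩ := hfreq 0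
  obtain ⟨j, hij, hj⟩ := hfreq (i + 1)
  have hjK : f (K j) ∈ K (i + 1) := hKa hij (hfF _ (hKM j))
  exact hg _ (hKM i) _ hjK.2 (hUW ⟨hi, hj⟩)

/-- A compact Hausdorff space with a `Gδ` diagonal is metrizable. -/
theorem TopologicalSpace.MetrizableSpace.of_compact_of_diagonal {X : Type*} [TopologicalSpace X]
    [CompactSpace X] [T2Space X] {W : ℕ → Set (X × X)} (hWo : ∀ n, IsOpen (W n))
    (hW : ⋂ n, W n = diagonal X) : TopologicalSpace.MetrizableSpace X := by
  have hdiag : ∀ n, diagonal X ⊆ W n := fun n => hW ▸ iInter_subset W n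
  choose V hVo hdV hVW using fun n =>
    normal_exists_closure_subset (isClosed_diagonal (X := X)) (hWo n) (hdiag n)
  let := uniformSpaceOfCompactR1 (γ := X)
  have hbasis : (uniformity X).HasBasis (fun _ : ℕ => True) fun n => ⋂ k ≤ n, closure (V k) := by
    rw [← nhdsSet_diagonal_eq_uniformity]
    refine ⟨fun U => ⟨fun hU => ?_, ?_⟩⟩
    · obtain ⟨n, hn⟩ := exists_subset_nhds_of_isCompact
        (V := fun n => ⋂ k ≤ n, closure (V k)) (U := U)
        (directed_of_isDirected_le fun m n hmn =>
          biInter_subset_biInter_left fun k (hk : k ≤ m) => hk.trans hmn)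
        (fun n => (isClosed_biInter fun k _ => isClosed_closure).isCompact)
        (fun p hp => by
          have hpd : p ∈ diagonal X := hW ▸ mem_iInter.2 fun n =>
            hVW n (mem_iInter₂.1 (mem_iInter.1 hp n) n le_rfl)
          exact mem_nhdsSet_iff_forall.1 hU p hpd)
      exact ⟨n, trivial, hn⟩
    · rintro ⟨n, -, hn⟩
      refine mem_of_superset ?_ hn
      refine (biInter_mem (finite_Iic n)).2 fun k _ => ?_
      exact mem_of_superset ((hVo k).mem_nhdsSet.2 (hdV k)) subset_closure
  have : (uniformity X).IsCountablyGenerated := hbasis.isCountablyGenerated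
  exact UniformSpace.metrizableSpace

/-- In a regular countably compact space, a point that is the intersection of countably many of its
neighborhoods has a countable neighborhood base. -/
theorem isCountablyGenerated_nhds_of_iInter {X : Type*} [TopologicalSpace X] [RegularSpace X]
    [CountablyCompactSpace X] {x : X} {G : ℕ → Set X} (hG : ∀ n, G n ∈ 𝓝 x)
    (hGx : ⋂ n, G n ⊆ {x}) : (𝓝 x).IsCountablyGenerated := by
  have hclosed := fun n => (closed_nhds_basis x).mem_iff.1 (hG n)
  choose V hV hVG using hclosed
  have hbasis : (𝓝 x).HasBasis (fun _ : ℕ => True) fun n => ⋂ k ≤ n, V k := by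
    refine ⟨fun U => ⟨fun hU => ?_, ?_⟩⟩
    · by_contra! hcon
      have hex : ∀ n, ∃ y ∈ ⋂ k ≤ n, V k, y ∉ interior U := fun n =>
        not_subset.1 fun h => hcon n trivial (h.trans interior_subset)
      choose a haV haU using hex
      obtain ⟨y, hy⟩ := CountablyCompactSpace.exists_mapClusterPt a
      have hyV : y ∈ ⋂ k, G k := mem_iInter.2 fun k => hVG k <|
        (hV k).2.mem_of_mapClusterPt hy <| eventually_atTop.2
          ⟨k, fun n hn => mem_iInter₂.1 (haV n) k hn⟩
      have hyU : y ∈ (interior U)ᶜ :=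
        isOpen_interior.isClosed_compl.mem_of_mapClusterPt hy (Eventually.of_forall haU)
      rw [hGx hyV] at hyU
      exact hyU (mem_interior_iff_mem_nhds.2 hU)
    · rintro ⟨n, -, hn⟩
      exact mem_of_superset ((biInter_mem (finite_Iic n)).2 fun k _ => (hV k).1) hn
  exact hbasis.isCountablyGenerated

/-- In a `T₁` space, a set accumulates at each point of its closure outside of it. -/
theorem Accumulates.of_mem_closure {Y : Type*} [TopologicalSpace Y] [T1Space Y] {A : Set Y} {e : Y}
    (he : e ∈ closure A) (heA : e ∉ A) : Accumulates A e := by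
  intro O hO hfin
  have hmem : O ∩ (O ∩ A)ᶜ ∈ 𝓝 e :=
    inter_mem hO (hfin.isClosed.isOpen_compl.mem_nhds fun h => heA h.2)
  obtain ⟨y, ⟨hyO, hy⟩, hyA⟩ := mem_closure_iff_nhds.1 he _ hmem
  exact hy ⟨hyO, hyA⟩

/-- The strong Pytkeev property implies countable tightness. -/
theorem StrongPytkeevAt.exists_countable_subset {Y : Type*} [TopologicalSpace Y] [T1Space Y] {e : Y}
    (hY : StrongPytkeevAt Y e) {A : Set Y} (he : e ∈ closure A) :
    ∃ B ⊆ A, B.Countable ∧ e ∈ closure B := by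
  by_cases heA : e ∈ A
  · exact ⟨{e}, singleton_subset_iff.2 heA, countable_singleton e, subset_closure rfl⟩
  obtain ⟨𝒩, hc, hN⟩ := hY
  have hchoice : ∀ N : Set Y, ∃ y, (N ∩ A).Nonempty → y ∈ N ∩ A := fun N => by
    by_cases h : (N ∩ A).Nonempty
    · exact ⟨h.some, fun _ => h.some_mem⟩
    · exact ⟨e, fun h' => absurd h' h⟩
  choose f hf using hchoice
  refine ⟨f '' {N ∈ 𝒩 | (N ∩ A).Nonempty}, ?_, (hc.mono (sep_subset _ _)).image f,
    mem_closure_iff_nhds.2 fun O hO => ?_⟩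
  · rintro _ ⟨N, ⟨-, hNA⟩, rfl⟩
    exact (hf N hNA).2
  · obtain ⟨N, hN𝒩, hNO, hinf⟩ := hN O hO A (.of_mem_closure he heA)
    exact ⟨f N, hNO (hf N hinf.nonempty).1, N, ⟨hN𝒩, hinf.nonempty⟩, rfl⟩

/-- `M` is an increasing sequence of sets containing `e` such that each set accumulating at `e` has
infinite intersection with some member of the sequence. -/
structure IsPytkeevChainAt {Y : Type*} [TopologicalSpace Y] (M : ℕ → Set Y) (e : Y) : Prop where
  monotone : Monotone M
  mem : ∀ n, e ∈ M n
  exists_infinite : ∀ A, Accumulates A e → ∃ n, (M n ∩ A).Infinite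

/-- Under the strong Pytkeev property, each neighborhood contains a Pytkeev chain with members taken
from a fixed countable family. -/
theorem StrongPytkeevAt.exists_chain {Y : Type*} [TopologicalSpace Y] {e : Y}
    (hY : StrongPytkeevAt Y e) : ∃ 𝒞 : Set (Set Y), 𝒞.Countable ∧
      ∀ O ∈ 𝓝 e, ∃ M, IsPytkeevChainAt M e ∧ ∀ n, M n ∈ 𝒞 ∧ M n ⊆ O := by
  obtain ⟨𝒩, hc, hN⟩ := hY
  refine ⟨(fun t => insert e (⋃₀ t)) '' {t | t.Finite ∧ t ⊆ insert ∅ 𝒩},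
    (countable_ofPred_finite_subset (hc.insert ∅)).image _, fun O hO => ?_⟩
  obtain ⟨f, hf⟩ := ((hc.insert ∅).mono (sep_subset _ fun N => N ⊆ O)).exists_eq_range
    ⟨∅, mem_insert _ _, empty_subset O⟩
  have hfmem : ∀ n, f n ∈ {N ∈ insert ∅ 𝒩 | N ⊆ O} := fun n => hf ▸ mem_range_self n
  refine ⟨fun n => insert e (⋃₀ (f '' Iic n)), ⟨fun m n hmn => ?_, fun n => mem_insert _ _,
    fun A hA => ?_⟩, fun n => ⟨⟨f '' Iic n, ⟨(finite_Iic n).image f, ?_⟩, rfl⟩, ?_⟩⟩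
  · exact insert_subset_insert (sUnion_subset_sUnion (image_mono (Iic_subset_Iic.2 hmn)))
  · obtain ⟨N, hN𝒩, hNO, hinf⟩ := hN O hO A hA
    obtain ⟨n, rfl⟩ : N ∈ range f := hf ▸ ⟨mem_insert_of_mem _ hN𝒩, hNO⟩
    exact ⟨n, hinf.mono (inter_subset_inter_left _ ((subset_sUnion_of_mem
      (mem_image_of_mem f (mem_Iic.2 le_rfl))).trans (subset_insert _ _)))⟩
  · exact image_subset_iff.2 fun k _ => (hfmem k).1
  · refine insert_subset (mem_of_mem_nhds hO) (sUnion_subset ?_)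
    rintro _ ⟨k, -, rfl⟩
    exact (hfmem k).2

namespace IsPytkeevChainAt

variable {X Y : Type*} [TopologicalSpace X] [TopologicalSpace Y] [T1Space Y] {M : ℕ → Set Y} {e : Y}

/-- Finite sets `F n` avoiding the members `M n` of a Pytkeev chain at `e` cannot have `e` in the
closure of their union. -/
theorem notMem_closure_iUnion (hM : IsPytkeevChainAt M e) {F : ℕ → Set Y}
    (hfin : ∀ n, (F n).Finite) (hdisj : ∀ n, ∀ y ∈ F n, y ∉ M n) : e ∉ closure (⋃ n, F n) := by
  intro he
  have heF : e ∉ ⋃ n, F n := fun h => by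
    obtain ⟨n, hn⟩ := mem_iUnion.1 h
    exact hdisj n e hn (hM.mem n)
  obtain ⟨k, hk⟩ := hM.exists_infinite _ (.of_mem_closure he heF)
  refine hk (((finite_Iio k).biUnion fun n _ => hfin n).subset ?_)
  rintro y ⟨hyM, hy⟩
  obtain ⟨n, hn⟩ := mem_iUnion.1 hy
  refine mem_iUnion₂.2 ⟨n, mem_Iio.2 (lt_of_not_ge fun hkn => ?_), hn⟩
  exact hdisj n y hn (hM.monotone hkn hyM)

/-- The preimage of some member of a Pytkeev chain under a continuous map on a regular countably
compact space is a neighborhood of any given point of the fiber over `e`. -/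
theorem exists_preimage_mem_nhds [RegularSpace X] [CountablyCompactSpace X]
    (hM : IsPytkeevChainAt M e) (hY : StrongPytkeevAt Y e) {p : X → Y} (hp : Continuous p) {x : X}
    (hx : p x = e) : ∃ n, p ⁻¹' M n ∈ 𝓝 x := by
  by_contra! hcon
  let Z : Set X := {z | ∃ a : ℕ → X, (∀ n, p (a n) ∉ M n) ∧ MapClusterPt z atTop a}
  have hxZ : x ∈ closure Z := by
    refine mem_closure_iff_nhds.2 fun U hU => ?_
    obtain ⟨V, ⟨hV, hVcl⟩, hVU⟩ := (closed_nhds_basis x).mem_iff.1 hU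
    have hex : ∀ n, ∃ y ∈ V, p y ∉ M n := fun n =>
      not_subset.1 fun h => hcon n (mem_of_superset hV h)
    choose a haV haM using hex
    obtain ⟨z, hz⟩ := CountablyCompactSpace.exists_mapClusterPt a
    exact ⟨z, hVU (hVcl.mem_of_mapClusterPt hz (Eventually.of_forall haV)), a, haM, hz⟩
  have heZ : e ∈ closure (p '' Z) := hx ▸ mem_closure_image hp.continuousAt hxZ
  obtain ⟨B, hBZ, hBc, heB⟩ := hY.exists_countable_subset heZ
  obtain ⟨b, rfl⟩ := hBc.exists_eq_range (closure_nonempty_iff.1 ⟨e, heB⟩)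
  have hsel : ∀ i, ∃ z, ∃ a : ℕ → X, (∀ n, p (a n) ∉ M n) ∧ MapClusterPt z atTop a ∧ p z = b i :=
    fun i => by
      obtain ⟨z, ⟨a, ha, hz⟩, hzb⟩ := hBZ (mem_range_self i)
      exact ⟨z, a, ha, hz, hzb⟩
  choose z a haM hz hzb using hsel
  refine hM.notMem_closure_iUnion (F := fun n => (fun i => p (a i n)) '' Iic n)
    (fun n => (finite_Iic n).image _) ?_ (closure_minimal ?_ isClosed_closure heB)
  · rintro n _ ⟨i, -, rfl⟩
    exact haM i n
  · rintro _ ⟨i, rfl⟩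
    rw [← hzb i]
    refine mem_closure_iff_nhds.2 fun O hO => ?_
    obtain ⟨n, hin, hn⟩ := frequently_atTop.1
      (mapClusterPt_iff_frequently.1 (hz i) _ (hp.continuousAt hO)) i
    exact ⟨p (a i n), hn, mem_iUnion.2 ⟨n, i, hin, rfl⟩⟩

/-- The conclusion of `exists_preimage_mem_nhds` holds at a point with a countable neighborhood base
in any space. -/
theorem exists_preimage_mem_nhds_of_isCountablyGenerated (hM : IsPytkeevChainAt M e) {p : X → Y}
    (hp : Continuous p) {x : X} [(𝓝 x).IsCountablyGenerated] (hx : p x = e) :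
    ∃ n, p ⁻¹' M n ∈ 𝓝 x := by
  by_contra! hcon
  obtain ⟨u, hu⟩ := (𝓝 x).exists_antitone_basis
  have hex : ∀ n, ∃ y ∈ u n, p y ∉ M n := fun n =>
    not_subset.1 fun h => hcon n (mem_of_superset (hu.mem n) h)
  choose a hau haM using hex
  refine hM.notMem_closure_iUnion (F := fun n => {p (a n)}) (fun n => finite_singleton _)
    (by rintro n _ rfl; exact haM n) ?_
  refine mem_closure_of_tendsto (hx ▸ (hp.tendsto x).comp (hu.tendsto hau))
    (Eventually.of_forall fun n => mem_iUnion.2 ⟨n, rfl⟩)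

end IsPytkeevChainAt

section

variable {X Y : Type*} [TopologicalSpace X] [RegularSpace X] [CountablyCompactSpace X]
  [TopologicalSpace Y] [T1Space Y] {e : Y} {q : X × X → Y}

theorem StrongPytkeevAt.isCountablyGenerated_nhds (hY : StrongPytkeevAt Y e) (hq : Continuous q)
    (hqe : q ⁻¹' {e} = diagonal X) (x : X) : (𝓝 x).IsCountablyGenerated := by
  have hqx : q (x, x) = e := hqe.ge (mem_diagonal x)
  obtain ⟨𝒞, hc, h𝒞⟩ := hY.exists_chain
  have hex : ∀ O ∈ 𝓝 e, ∃ N ∈ {N ∈ 𝒞 | (fun y => q (x, y)) ⁻¹' N ∈ 𝓝 x}, N ⊆ O := fun O hO => by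
    obtain ⟨M, hM, hM𝒞⟩ := h𝒞 O hO
    obtain ⟨n, hn⟩ := hM.exists_preimage_mem_nhds hY (hq.comp (Continuous.prodMk_right x)) hqx
    exact ⟨M n, ⟨(hM𝒞 n).1, hn⟩, (hM𝒞 n).2⟩
  obtain ⟨N, hN, -⟩ := hex univ univ_mem
  obtain ⟨f, hf⟩ := (hc.mono (sep_subset _ _)).exists_eq_range ⟨N, hN⟩
  rw [hf] at hex
  refine isCountablyGenerated_nhds_of_iInter (G := fun n => (fun y => q (x, y)) ⁻¹' f n)
    (fun n => (hf.ge (mem_range_self n)).2) fun y hy => ?_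
  by_contra hyx
  have hne : e ≠ q (x, y) := fun h => hyx (hqe.le (show (x, y) ∈ q ⁻¹' {e} from h.symm)).symm
  obtain ⟨_, ⟨n, rfl⟩, hn⟩ := hex _ (isOpen_compl_singleton.mem_nhds hne)
  exact hn (mem_iInter.1 hy n) rfl

theorem StrongPytkeevAt.exists_isOpen_iInter_eq_diagonal (hY : StrongPytkeevAt Y e)
    (hq : Continuous q) (hqe : q ⁻¹' {e} = diagonal X) :
    ∃ W : ℕ → Set (X × X), (∀ n, IsOpen (W n)) ∧ ⋂ n, W n = diagonal X := by
  have := fun x => hY.isCountablyGenerated_nhds hq hqe x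
  obtain ⟨𝒞, hc, h𝒞⟩ := hY.exists_chain
  have hex : ∀ O ∈ 𝓝 e, ∃ N ∈ {N ∈ 𝒞 | diagonal X ⊆ interior (q ⁻¹' N)}, N ⊆ O := fun O hO => by
    obtain ⟨M, hM, hM𝒞⟩ := h𝒞 O hO
    obtain ⟨n, hn⟩ := (CountablyCompactSpace.isCountablyCompact_univ (E := X)).elim_directed_cover
      (fun n => (fun x => (x, x)) ⁻¹' interior (q ⁻¹' M n))
      (fun n => isOpen_interior.preimage (by fun_prop))
      (fun x _ => by
        have : (𝓝 (x, x)).IsCountablyGenerated := by rw [nhds_prod_eq]; infer_instance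
        obtain ⟨n, hn⟩ := hM.exists_preimage_mem_nhds_of_isCountablyGenerated hq
          (hqe.ge (mem_diagonal x))
        exact mem_iUnion.2 ⟨n, mem_interior_iff_mem_nhds.2 hn⟩)
      (directed_of_isDirected_le fun m n hmn =>
        preimage_mono (interior_mono (preimage_mono (hM.monotone hmn))))
    refine ⟨M n, ⟨(hM𝒞 n).1, ?_⟩, (hM𝒞 n).2⟩
    rintro ⟨x, y⟩ (rfl : x = y)
    exact hn (mem_univ x)
  obtain ⟨N, hN, -⟩ := hex univ univ_mem
  obtain ⟨f, hf⟩ := (hc.mono (sep_subset _ _)).exists_eq_range ⟨N, hN⟩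
  rw [hf] at hex
  refine ⟨fun n => interior (q ⁻¹' f n), fun n => isOpen_interior,
    Subset.antisymm (fun p hp => ?_) (subset_iInter fun n => (hf.ge (mem_range_self n)).2)⟩
  by_contra hpd
  have hne : e ≠ q p := fun h => hpd (hqe.le (show p ∈ q ⁻¹' {e} from h.symm))
  obtain ⟨_, ⟨n, rfl⟩, hn⟩ := hex _ (isOpen_compl_singleton.mem_nhds hne)
  have hpn := interior_subset (mem_iInter.1 hp n)
  exact hn hpn rfl

end

/-- Let `X` be a regular countably compact space whose square has countable fan
open-tightness at every point of the diagonal, `Y` a T₁ space, `e ∈ Y`, and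
`q : X × X → Y` a continuous map with `q⁻¹{e} = Δ_X`. If `Y` has the strong Pytkeev
property at `e`, then `X` is metrizable. -/
theorem metrizable_of_strongPytkeev_diagonal {X Y : Type*} [TopologicalSpace X]
    [RegularSpace X] [TopologicalSpace Y] [T1Space Y]
    (hcc : ∀ A : Set X, A.Infinite → ∃ x : X, Accumulates A x)
    (hfan : ∀ x : X, FanOpenTightnessAt (X × X) (x, x))
    (e : Y) (q : X × X → Y) (hq : Continuous q)
    (hqe : q ⁻¹' {e} = {p : X × X | p.1 = p.2})
    (hY : StrongPytkeevAt Y e) :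
    TopologicalSpace.MetrizableSpace X := by
  have hdiag : q ⁻¹' {e} = diagonal X := hqe
  have : T2Space X := t2_iff_isClosed_diagonal.2 (hdiag ▸ isClosed_singleton.preimage hq)
  have := CountablyCompactSpace.of_forall_exists_accumulates hcc
  obtain ⟨W, hWo, hW⟩ := hY.exists_isOpen_iInter_eq_diagonal hq hdiag
  have := CompactSpace.of_countablyCompact_of_diagonal hWo hW
  exact TopologicalSpace.MetrizableSpace.of_compact_of_diagonal hWo hW
end

section
/- Let X be a regular countably compact topological space (every infinite subset of X has an accumulation point in X) such that the square X×X has countable fan open-tightness at every point of the diagonal Δ_X = {(x,x) : x ∈ X} and X×X is Fréchet–Urysohn at every point of Δ_X. Let Y be a T₁ topological space, e ∈ Y, and let q : X×X → Y be a continuous map with q⁻¹({e}) = Δ_X. If Y has countable cs*-character at e, then X is metrizable. -/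
open Set Filter Topology

/-- A convergent sequence of points taken from finite sets, none of which contains the limit,
visits each of these sets only finitely often. -/
theorem tendsto_atTop_of_mem_finite {Z : Type*} [TopologicalSpace Z] [T1Space Z] {z : Z}
    {R : ℕ → Set Z} (hR : ∀ n, (R n).Finite) (hz : ∀ n, z ∉ R n) {b : ℕ → Z}
    (hb : Tendsto b atTop (𝓝 z)) {n : ℕ → ℕ} (hn : ∀ i, b i ∈ R (n i)) :
    Tendsto n atTop atTop := by
  refine tendsto_atTop.2 fun N => ?_
  have hfin : (⋃ k ∈ Finset.range N, R k).Finite := Set.Finite.biUnion (Finset.finite_toSet _)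
    fun k _ => hR k
  have hmem : (⋃ k ∈ Finset.range N, R k)ᶜ ∈ 𝓝 z :=
    hfin.isClosed.isOpen_compl.mem_nhds (by simp [hz])
  filter_upwards [hb hmem] with i hi
  by_contra h
  exact hi (mem_biUnion (Finset.mem_coe.2 (Finset.mem_range.2 (not_le.1 h))) (hn i))

/-- In a regular countably compact space, a Fréchet–Urysohn point is strongly
Fréchet–Urysohn. -/
theorem FrechetUrysohnAt.exists_seq_of_antitone {Z : Type*} [TopologicalSpace Z] [T3Space Z]
    [CountablyCompactSpace Z] {z : Z} (hz : FrechetUrysohnAt Z z) {A : ℕ → Set Z}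
    (hA : Antitone A) (hzA : ∀ n, z ∈ closure (A n)) :
    ∃ (b : ℕ → Z) (n : ℕ → ℕ), Tendsto b atTop (𝓝 z) ∧ Tendsto n atTop atTop ∧
      ∀ i, b i ∈ A (n i) := by
  by_cases hall : ∀ n, z ∈ A n
  · exact ⟨fun _ => z, id, tendsto_const_nhds, tendsto_id, hall⟩
  push Not at hall
  obtain ⟨m, hm⟩ := hall
  have hC : z ∈ closure {c | ∃ a : ℕ → Z, (∀ n, a n ∈ A n) ∧ MapClusterPt c atTop a} := by
    refine (mem_closure_iff_nhds_basis (closed_nhds_basis z)).2 ?_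
    rintro V ⟨hV, hVc⟩
    choose a ha using fun n => mem_closure_iff_nhds.1 (hzA n) V hV
    obtain ⟨c, hcV, hc⟩ := isCountablyCompact_iff_seq_clusterPt.1 hVc.isCountablyCompact a
      (Eventually.of_forall fun n => (ha n).1)
    exact ⟨c, ⟨a, fun n => (ha n).2, hc⟩, hcV⟩
  obtain ⟨c, hc, hcz⟩ := hz _ hC
  choose a ha hac using hc
  let R : ℕ → Set Z := fun n => {y | m ≤ n ∧ ∃ j ≤ n, a j n = y}
  have hRA : ∀ n, R n ⊆ A n := by
    rintro n y ⟨-, j, -, rfl⟩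
    exact ha j n
  have hR : ∀ n, (R n).Finite := fun n =>
    ((Set.finite_Iic n).image fun j => a j n).subset fun y hy => hy.2
  have hzR : ∀ n, z ∉ R n := fun n h => hm (hA h.1 (hRA n h))
  have hcR : ∀ j, c j ∈ closure (⋃ n, R n) := by
    refine fun j => mem_closure_iff_nhds.2 fun O hO => ?_
    obtain ⟨n, hn, hnO⟩ := (mapClusterPt_iff_frequently.1 (hac j) O hO).forall_exists_of_atTop
      (max j m)
    exact ⟨a j n, hnO, mem_iUnion.2 ⟨n, le_trans (le_max_right _ _) hn, j,
      le_trans (le_max_left _ _) hn, rfl⟩⟩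
  obtain ⟨b, hb, hbz⟩ := hz _ <| isClosed_closure.mem_of_tendsto hcz (Eventually.of_forall hcR)
  choose n hn using fun i => mem_iUnion.1 (hb i)
  exact ⟨b, n, hbz, tendsto_atTop_of_mem_finite hR hzR hbz hn, fun i => hRA _ (hn i)⟩

/-- A product of sequentially compact spaces is sequentially compact. -/
theorem SeqCompactSpace.prod (X Y : Type*) [TopologicalSpace X] [TopologicalSpace Y]
    [SeqCompactSpace X] [SeqCompactSpace Y] : SeqCompactSpace (X × Y) := by
  refine ⟨fun u _ => ?_⟩
  obtain ⟨x, φ, hφ, hx⟩ := SeqCompactSpace.tendsto_subseq fun n => (u n).1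
  obtain ⟨y, ψ, hψ, hy⟩ := SeqCompactSpace.tendsto_subseq fun n => (u (φ n)).2
  exact ⟨(x, y), mem_univ _, φ ∘ ψ, hφ.comp hψ,
    (hx.comp hψ.tendsto_atTop).prodMk_nhds hy⟩

/-- Every filter with a basis of closed sets is refined by a minimal such filter. -/
theorem exists_minimal_closed_filter {X : Type*} [TopologicalSpace X] (g : Filter X) [NeBot g] :
    ∃ f : Filter X, NeBot f ∧ (∀ s ∈ g, closure s ∈ f) ∧
      (∀ s ∈ f, ∃ K ∈ f, IsClosed K ∧ K ⊆ s) ∧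
      ∀ C, IsClosed C → (∀ s ∈ f, (C ∩ s).Nonempty) → C ∈ f := by
  let S : Set (Filter X)ᵒᵈ :=
    {f | NeBot (OrderDual.ofDual f) ∧ ∀ s ∈ OrderDual.ofDual f,
      ∃ K ∈ OrderDual.ofDual f, IsClosed K ∧ K ⊆ s}
  have hg : OrderDual.toDual (g.lift' closure) ∈ S := by
    refine ⟨?_, fun s hs => ?_⟩
    · exact NeBot.mono ‹_› g.le_lift'_closure
    · obtain ⟨t, ht, hts⟩ := (mem_lift'_sets (monotone_closure X)).1 hs
      exact ⟨closure t, mem_lift' ht, isClosed_closure, hts⟩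
  obtain ⟨f, hgf, hf⟩ := zorn_le_nonempty₀ S (fun c hcS hc y hy => by
    let c' : Set (Filter X) := OrderDual.toDual ⁻¹' c
    have hdir : DirectedOn (· ≥ ·) c' := (show IsChain (· ≥ ·) c' from hc).directedOn
    have hne : c'.Nonempty := ⟨OrderDual.ofDual y, hy⟩
    have hmem : ∀ s, s ∈ sInf c' ↔ ∃ f ∈ c', s ∈ f := fun s => by
      rw [sInf_eq_iInf]
      exact mem_biInf_of_directed hdir hne
    refine ⟨OrderDual.toDual (sInf c'), ⟨?_, fun s hs => ?_⟩,
      fun f hf => sInf_le (show OrderDual.ofDual f ∈ c' from hf)⟩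
    · exact sInf_neBot_of_directed' hne hdir fun h => (hcS h).1.ne rfl
    · obtain ⟨f, hf, hsf⟩ := (hmem s).1 hs
      obtain ⟨K, hK, hKc, hKs⟩ := (hcS hf).2 s hsf
      exact ⟨K, (hmem K).2 ⟨f, hf, hK⟩, hKc, hKs⟩) _ hg
  refine ⟨OrderDual.ofDual f, hf.prop.1, fun s hs => hgf (mem_lift' hs), hf.prop.2,
    fun C hC hCf => ?_⟩
  have hmem : OrderDual.toDual (OrderDual.ofDual f ⊓ 𝓟 C) ∈ S := by
    refine ⟨inf_principal_neBot_iff.2 fun s hs => inter_comm C s ▸ hCf s hs, fun s hs => ?_⟩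
    obtain ⟨K, hK, hKc, hKs⟩ := hf.prop.2 _ (mem_inf_principal.1 hs)
    exact ⟨K ∩ C, inter_mem_inf hK (mem_principal_self C), hKc.inter hC, fun x hx => hKs hx.1 hx.2⟩
  have hle : OrderDual.ofDual f ≤ OrderDual.ofDual f ⊓ 𝓟 C := 
    hf.le_of_ge hmem (show OrderDual.ofDual f ⊓ 𝓟 C ≤ OrderDual.ofDual f from inf_le_left)
  exact le_principal_iff.1 (hle.trans inf_le_right)

/-- **Chaber's theorem**: a countably compact space with a `Gδ` diagonal is compact. -/
theorem compactSpace_of_isGδ_diagonal {X : Type*} [TopologicalSpace X]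
    [CountablyCompactSpace X] (hX : IsGδ (diagonal X)) : CompactSpace X := by
  obtain ⟨U, hUo, hU⟩ := isGδ_iff_eq_iInter_nat.1 hX
  have hdiag : ∀ n x, (x, x) ∈ U n := fun n x =>
    mem_iInter.1 (hU ▸ mem_diagonal x : (x, x) ∈ ⋂ n, U n) n
  refine ⟨fun g _ _ => ?_⟩
  obtain ⟨f, hfne, hgf, hfc, hmax⟩ := exists_minimal_closed_filter g
  have hfinter : ∀ F : ℕ → Set X, (∀ n, F n ∈ f) → ⋂ n, F n ∈ f := by
    intro F hF
    choose K hKf hKc hKF using fun n => hfc _ (hF n)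
    refine mem_of_superset (hmax (⋂ n, K n) (isClosed_iInter hKc) fun s hs => ?_)
      (iInter_mono hKF)
    obtain ⟨L, hLf, hLc, hLs⟩ := hfc s hs
    have hmem : ∀ n, L ∩ ⋂ i ∈ Finset.range (n + 1), K i ∈ f := fun n =>
      inter_mem hLf ((Filter.biInter_finset_mem _).2 fun i _ => hKf i)
    choose u hu using fun n => hfne.nonempty_of_mem (hmem n)
    obtain ⟨x, hxL, hx⟩ := isCountablyCompact_iff_seq_clusterPt.1 hLc.isCountablyCompact u
      (Eventually.of_forall fun n => (hu n).1)
    refine ⟨x, mem_iInter.2 fun i => ?_, hLs hxL⟩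
    refine (hKc i).closure_subset (ClusterPt.mem_closure_of_mem hx (K i) (mem_map.2 ?_))
    filter_upwards [eventually_ge_atTop i] with n hn
    exact mem_iInter₂.1 (hu n).2 i (Finset.mem_range.2 (by omega))
  suffices h : ∃ x, ∀ n, {y | (x, y) ∈ U n}ᶜ ∉ f by
    obtain ⟨x, hx⟩ := h
    have hxf : {x} ∈ f := by
      have hmem : ∀ n, {y | (x, y) ∈ U n} ∈ f := fun n => by
        have hopen : IsOpen {y | (x, y) ∈ U n} := (hUo n).preimage (Continuous.prodMk_right x)
        by_contra hn
        refine hx n (hmax _ hopen.isClosed_compl fun s hs => ?_)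
        rw [inter_comm]
        exact inter_compl_nonempty_iff.2 fun h => hn (mem_of_superset hs h)
      refine mem_of_superset (hfinter _ hmem) fun y hy => ?_
      have : (x, y) ∈ diagonal X := hU ▸ mem_iInter.2 fun n => mem_iInter.1 hy n
      exact (mem_diagonal_iff.1 this).symm
    refine ⟨x, mem_univ x, clusterPt_iff_forall_mem_closure.2 fun s hs => ?_⟩
    obtain ⟨y, hy, rfl⟩ := hfne.nonempty_of_mem (inter_mem (hgf s hs) hxf)
    exact hy
  by_contra! hcon
  obtain ⟨n, hn⟩ : ∃ n, ∀ s ∈ f, ∃ x ∈ s, {y | (x, y) ∈ U n}ᶜ ∈ f := by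
    by_contra! h
    choose F hF hFU using h
    obtain ⟨x, hx⟩ := hfne.nonempty_of_mem (hfinter F hF)
    obtain ⟨n, hn⟩ := hcon x
    exact hFU n x (mem_iInter.1 hx n) hn
  obtain ⟨u, -, hu⟩ := exists_seq_of_forall_finset_exists
    (fun x => {y | (x, y) ∈ U n}ᶜ ∈ f) (fun x y => (x, y) ∉ U n) fun s hs => by
      obtain ⟨y, hy, hyf⟩ := hn _ ((Filter.biInter_finset_mem s).2 hs)
      exact ⟨y, hyf, fun x hx => mem_iInter₂.1 hy x hx⟩
  obtain ⟨x, -, hx⟩ := isCountablyCompact_iff_seq_clusterPt.1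
    (CountablyCompactSpace.isCountablyCompact_univ (E := X)) u (by simp)
  obtain ⟨G, hG, hGU⟩ := mem_prod_same_iff.1
    (nhds_prod_eq (x := x) (y := x) ▸ (hUo n).mem_nhds (hdiag n x))
  have hfreq := mapClusterPt_iff_frequently.1 hx G hG
  obtain ⟨i, hi⟩ := hfreq.exists
  obtain ⟨k, hk, hkG⟩ := hfreq.forall_exists_of_atTop (i + 1)
  exact hu i k (by omega) (hGU ⟨hi, hkG⟩)

/-- A compact Hausdorff space with a `Gδ` diagonal is metrizable. -/
theorem metrizableSpace_of_compact_of_isGδ_diagonal {X : Type*} [TopologicalSpace X]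
    [CompactSpace X] [T2Space X] (hX : IsGδ (diagonal X)) :
    TopologicalSpace.MetrizableSpace X := by
  obtain ⟨U, hUo, hU⟩ := isGδ_iff_eq_iInter_nat.1 hX
  choose V hVo hV hVU using fun n =>
    normal_exists_closure_subset isClosed_diagonal (hUo n) (hU ▸ iInter_subset U n)
  let K : ℕ → Set (X × X) := fun n => ⋂ i ∈ Finset.range (n + 1), closure (V i)
  have hKanti : Antitone K := fun m n hmn => biInter_subset_biInter_left fun i hi =>
    Finset.range_mono (Nat.succ_le_succ hmn) hi
  have hKc : ∀ n, IsClosed (K n) := fun n => isClosed_biInter fun _ _ => isClosed_closure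
  have hKmem : ∀ n, K n ∈ 𝓝ˢ (diagonal X) := fun n => (Filter.biInter_finset_mem _).2 fun i _ =>
    mem_of_superset ((hVo i).mem_nhdsSet.2 (hV i)) subset_closure
  have hKdiag : ⋂ n, K n ⊆ diagonal X := fun p hp => hU ▸ mem_iInter.2 fun n =>
    hVU n (mem_iInter₂.1 (mem_iInter.1 hp n) n (by simp))
  have hbasis : (𝓝ˢ (diagonal X)).HasBasis (fun _ : ℕ => True) K := by
    refine ⟨fun s => ⟨fun hs => ?_, fun ⟨n, _, hn⟩ => mem_of_superset (hKmem n) hn⟩⟩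
    obtain ⟨n, hn⟩ := exists_subset_nhds_of_isCompact hKanti.directed_ge
      (fun n => (hKc n).isCompact) (U := s) fun x hx => mem_nhdsSet_iff_forall.1 hs x (hKdiag hx)
    exact ⟨n, trivial, hn⟩
  let _ : UniformSpace X := uniformSpaceOfCompactR1
  have : IsCountablyGenerated (uniformity X) := hbasis.isCountablyGenerated
  exact UniformSpace.metrizableSpace

/-- A cs*-network at `e`, pulled back along `q`, contains for every neighborhood of `e` a finite
subfamily covering a neighborhood of the diagonal. -/
theorem IsCsStarNetworkAt.exists_finite_sUnion_mem_nhds {X Y : Type*} [TopologicalSpace X]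
    [T3Space X] [SeqCompactSpace X] [TopologicalSpace Y]
    (hFU : ∀ x : X, FrechetUrysohnAt (X × X) (x, x)) {e : Y} {q : X × X → Y} (hq : Continuous q)
    (hqe : ∀ x, q (x, x) = e) {𝒩 : Set (Set Y)} (hcount : 𝒩.Countable)
    (hcs : IsCsStarNetworkAt 𝒩 e) {O : Set Y} (hO : O ∈ 𝓝 e) :
    ∃ t ⊆ 𝒩, t.Finite ∧ ⋃₀ t ⊆ O ∧ ∀ x, q ⁻¹' ⋃₀ t ∈ 𝓝 (x, x) := by
  have := SeqCompactSpace.prod X X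
  have hne : {N ∈ 𝒩 | N ⊆ O}.Nonempty := by
    obtain ⟨N, hN, hNO, -⟩ := hcs O hO (fun _ => e) tendsto_const_nhds
    exact ⟨N, hN, hNO⟩
  obtain ⟨N, hN⟩ := (hcount.mono (sep_subset 𝒩 fun N => N ⊆ O)).exists_eq_range hne
  have hN𝒩 : ∀ n, N n ∈ 𝒩 ∧ N n ⊆ O := fun n => (hN ▸ mem_range_self n : N n ∈ {N ∈ 𝒩 | N ⊆ O})
  let T : ℕ → Set (Set Y) := fun n => N '' Iic n
  have hT : Monotone fun n => q ⁻¹' ⋃₀ T n := fun m n hmn =>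
    preimage_mono (sUnion_subset_sUnion (image_mono (Iic_subset_Iic.2 hmn)))
  have hlocal : ∀ x, ∃ n, q ⁻¹' ⋃₀ T n ∈ 𝓝 (x, x) := by
    intro x
    by_contra! h
    obtain ⟨b, n, hb, hn, hbn⟩ := (hFU x).exists_seq_of_antitone
      (A := fun n => (q ⁻¹' ⋃₀ T n)ᶜ) (fun _ _ hmn => compl_subset_compl.2 (hT hmn))
      fun n => by
        rw [closure_compl, mem_compl_iff, mem_interior_iff_mem_nhds]
        exact h n
    obtain ⟨M, hM, hMO, hinf⟩ := hcs O hO (q ∘ b) (hqe x ▸ (hq.tendsto (x, x)).comp hb)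
    obtain ⟨k, rfl⟩ : M ∈ range N := hN.subset ⟨hM, hMO⟩
    obtain ⟨i, hiM, hik⟩ := ((Nat.frequently_atTop_iff_infinite.2 hinf).and_eventually
      (hn.eventually_ge_atTop k)).exists
    exact hbn i ⟨N k, mem_image_of_mem N hik, hiM⟩
  obtain ⟨n, hn⟩ : ∃ n, ∀ x, q ⁻¹' ⋃₀ T n ∈ 𝓝 (x, x) := by
    by_contra! h
    choose u hu using h
    obtain ⟨x, φ, hφ, hx⟩ := SeqCompactSpace.tendsto_subseq u
    obtain ⟨m, hm⟩ := hlocal x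
    obtain ⟨i, hi, him⟩ := (((hx.prodMk_nhds hx).eventually
      (eventually_mem_nhds_iff.2 hm)).and (eventually_ge_atTop m)).exists
    exact hu (φ i) (mem_of_superset hi (hT (him.trans (hφ.id_le i))))
  exact ⟨T n, image_subset_iff.2 fun k _ => (hN𝒩 k).1, (finite_Iic n).image N,
    sUnion_subset (forall_mem_image.2 fun k _ => (hN𝒩 k).2), hn⟩

/-- Let `X` be a regular countably compact space whose square has countable fan
open-tightness and is Fréchet–Urysohn at every point of the diagonal, `Y` a T₁ space,
`e ∈ Y`, and `q : X × X → Y` continuous with `q⁻¹{e} = Δ_X`. If `Y` has countable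
cs*-character at `e`, then `X` is metrizable. -/
theorem metrizable_of_csStar_diagonal {X Y : Type*} [TopologicalSpace X]
    [RegularSpace X] [TopologicalSpace Y] [T1Space Y]
    (hcc : ∀ A : Set X, A.Infinite → ∃ x : X, Accumulates A x)
    (hfan : ∀ x : X, FanOpenTightnessAt (X × X) (x, x))
    (hFU : ∀ x : X, FrechetUrysohnAt (X × X) (x, x))
    (e : Y) (q : X × X → Y) (hq : Continuous q)
    (hqe : q ⁻¹' {e} = {p : X × X | p.1 = p.2})
    (𝒩 : Set (Set Y)) (hcount : 𝒩.Countable) (hcs : IsCsStarNetworkAt 𝒩 e) :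
    TopologicalSpace.MetrizableSpace X := by
  have hqd : ∀ p : X × X, q p = e ↔ p.1 = p.2 := fun p => Set.ext_iff.1 hqe p
  have : T2Space X := t2_iff_isClosed_diagonal.2 <| by
    have hcl : IsClosed (q ⁻¹' {e}) := isClosed_singleton.preimage hq
    rwa [hqe] at hcl
  have : FrechetUrysohnSpace X := ⟨fun A x hx => by
    obtain ⟨u, hu, hux⟩ := hFU x (A ×ˢ A) (by rw [closure_prod_eq]; exact ⟨hx, hx⟩)
    exact ⟨fun n => (u n).1, fun n => (hu n).1, (continuous_fst.tendsto _).comp hux⟩⟩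
  have : CountablyCompactSpace X := ⟨isCountablyCompact_iff_infinite_subset_has_accPt.2
    fun A _ hA => by
      obtain ⟨x, hx⟩ := hcc A hA
      refine ⟨x, mem_univ x, accPt_iff_nhds.2 fun O hO => ?_⟩
      obtain ⟨y, hy, hyx⟩ := (hx O hO).exists_notMem_finite (finite_singleton x)
      exact ⟨y, hy, hyx⟩⟩
  have hX : IsGδ (diagonal X) := by
    have hcountable : {t | t.Finite ∧ t ⊆ 𝒩 ∧ ∀ x, q ⁻¹' ⋃₀ t ∈ 𝓝 (x, x)}.Countable :=
      (countable_ofPred_finite_subset hcount).mono fun t ht => (⟨ht.1, ht.2.1⟩ : t.Finite ∧ t ⊆ 𝒩)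
    convert IsGδ.biInter_of_isOpen hcountable
      (fun t _ => isOpen_interior (s := q ⁻¹' ⋃₀ t)) using 1
    refine Subset.antisymm (fun p hp => mem_iInter₂.2 fun t ht => ?_) fun p hp => ?_
    · obtain ⟨x, y⟩ := p
      obtain rfl : x = y := hp
      exact mem_interior_iff_mem_nhds.2 (ht.2.2 x)
    · by_contra hne
      obtain ⟨t, ht𝒩, ht, htO, hnhds⟩ := hcs.exists_finite_sUnion_mem_nhds hFU hq
        (fun x => (hqd (x, x)).2 rfl) hcount
        (isOpen_compl_singleton.mem_nhds fun h => hne ((hqd p).1 (Eq.symm h)) : {q p}ᶜ ∈ 𝓝 e)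
      exact htO (interior_subset (s := q ⁻¹' ⋃₀ t) (mem_iInter₂.1 hp t ⟨ht, ht𝒩, hnhds⟩)) rfl
  have := compactSpace_of_isGδ_diagonal hX
  exact metrizableSpace_of_compact_of_isGδ_diagonal hX
end
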